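/- L² closeness of cavity fields: with U = ⟨Σ_{σ∈S} P0(σ)·exp(σ̄·z(x) + σ̄²·s(x))⟩_{n,ε} and V = Σ_{σ∈S} P0(σ)·exp(σ̄·√(λ/n)·Σ_{i=1}^n b_i·Z′_i + λQ·X′·σ̄ − (λQ/2)·σ̄²), one has ∫_0^{ε₀} E[(U − V)²] dε → 0 as n → ∞. -/

import Mathlib

open MeasureTheory ProbabilityTheory Filter Finset Real

noncomputable section

/-- The standard Gaussian measure on `ℝ`. -/
def stdGauss : Measure ℝ := gaussianReal 0 1

/-- The Bernoulli(ε) measure on `Bool`. -/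
def bern (ε : ℝ) : Measure Bool :=
  ENNReal.ofReal ε • Measure.dirac true + ENNReal.ofReal (1 - ε) • Measure.dirac false

instance (ε : ℝ) : IsFiniteMeasure (bern ε) := by
  constructor
  rw [bern, Measure.add_apply, Measure.smul_apply, Measure.smul_apply, smul_eq_mul,
    smul_eq_mul, measure_univ, measure_univ, mul_one, mul_one]
  exact ENNReal.add_lt_top.2 ⟨ENNReal.ofReal_lt_top, ENNReal.ofReal_lt_top⟩

/-- The set of pairs `(i, j)` with `i < j`. -/
def pairs (n : ℕ) : Finset (Fin n × Fin n) :=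
  Finset.univ.filter fun p => p.1 < p.2

/-- The ambient sample space of the cavity computation:
`(X, Z, L, Z″, Z̃)` where `X : Fin (n+1) → ℝ` is the signal, `Z` the Gaussian noise,
`L` the Bernoulli revelation variables, and `Z″, Z̃` the auxiliary Gaussians used in `y`. -/
abbrev CavΩ (n : ℕ) :=
  (Fin (n + 1) → ℝ) × ((Fin (n + 1) × Fin (n + 1)) → ℝ) × (Fin (n + 1) → Bool) ×
    (Fin (n + 1) → ℝ) × ((Fin (n + 1) × Fin (n + 1)) → ℝ)

/-- The law of `(X, Z, L, Z″, Z̃)`: all coordinates independent, `X_i` i.i.d. `P0`,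
`Z, Z″, Z̃` i.i.d. standard Gaussian, `L_i` i.i.d. Bernoulli(ε). -/
def cavMeas (P0 : Measure ℝ) [IsProbabilityMeasure P0] (n : ℕ) (ε : ℝ) :
    Measure (CavΩ n) :=
  (Measure.pi fun _ : Fin (n + 1) => P0).prod
    ((Measure.pi fun _ : Fin (n + 1) × Fin (n + 1) => stdGauss).prod
      ((Measure.pi fun _ : Fin (n + 1) => bern ε).prod
        ((Measure.pi fun _ : Fin (n + 1) => stdGauss).prod
          (Measure.pi fun _ : Fin (n + 1) × Fin (n + 1) => stdGauss))))

/-- `x̄_i = L_i X_i + (1 − L_i) x_i`. -/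
def xbar (n : ℕ) (ω : CavΩ n) (x : Fin n → ℝ) : Fin n → ℝ :=
  fun i => if ω.2.2.1 i.castSucc then ω.1 i.castSucc else x i

/-- `σ̄ = (1 − L_{n+1}) σ + L_{n+1} X′`. -/
def sigbar (n : ℕ) (ω : CavΩ n) (σ : ℝ) : ℝ :=
  if ω.2.2.1 (Fin.last n) then ω.1 (Fin.last n) else σ

/-- The cavity Hamiltonian `H′_n(x)`. -/
def Hcav (n : ℕ) (lam : ℝ) (ω : CavΩ n) (x : Fin n → ℝ) : ℝ :=
  ∑ p ∈ pairs n,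
    (Real.sqrt (lam / (n + 1)) * ω.2.1 (p.1.castSucc, p.2.castSucc) * x p.1 * x p.2
      + lam / (n + 1) * ω.1 p.1.castSucc * ω.1 p.2.castSucc * x p.1 * x p.2
      - lam / (2 * (n + 1)) * (x p.1) ^ 2 * (x p.2) ^ 2)

/-- The configurations `x ∈ Sⁿ`. -/
def confs (S : Finset ℝ) (n : ℕ) : Finset (Fin n → ℝ) :=
  Fintype.piFinset fun _ => S

/-- The weight `P0⊗n(x) = Π_i P0({x_i})`. -/
def weight (P0 : Measure ℝ) (n : ℕ) (x : Fin n → ℝ) : ℝ :=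
  ∏ i, (P0 {x i}).toReal

/-- The Gibbs average
`⟨f(x)⟩_{n,ε} = Σ_x P0⊗n(x) f(x̄) exp(H′_n(x̄)) / Σ_x P0⊗n(x) exp(H′_n(x̄))`. -/
def gibbs (P0 : Measure ℝ) (S : Finset ℝ) (n : ℕ) (lam : ℝ) (ω : CavΩ n)
    (f : (Fin n → ℝ) → ℝ) : ℝ :=
  (∑ x ∈ confs S n, weight P0 n x * f (xbar n ω x) * Real.exp (Hcav n lam ω (xbar n ω x)))
    / (∑ x ∈ confs S n, weight P0 n x * Real.exp (Hcav n lam ω (xbar n ω x)))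

/-- The normalized dot product `u · v = (1/n) Σ_i u_i v_i`. -/
def ndot (n : ℕ) (u v : Fin n → ℝ) : ℝ := (1 / n : ℝ) * ∑ i, u i * v i

/-- The cavity field `z(x) = √(λ/n) Σ_i x_i Z′_i + λ (x·X) X′`. -/
def zfield (n : ℕ) (lam : ℝ) (ω : CavΩ n) (x : Fin n → ℝ) : ℝ :=
  Real.sqrt (lam / n) * ∑ i : Fin n, x i * ω.2.1 (i.castSucc, Fin.last n)
    + lam * ndot n x (fun i => ω.1 i.castSucc) * ω.1 (Fin.last n)

/-- The cavity field `s(x) = −(λ/2) (x·x)`. -/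
def sfield (n : ℕ) (lam : ℝ) (x : Fin n → ℝ) : ℝ := -(lam / 2) * ndot n x x

/-- `b_i = ⟨x_i⟩_{n,ε}`. -/
def bcoef (P0 : Measure ℝ) (S : Finset ℝ) (n : ℕ) (lam : ℝ) (ω : CavΩ n)
    (i : Fin n) : ℝ :=
  gibbs P0 S n lam ω (fun x => x i)

/-- `Q = (1/n) Σ_i b_i²`. -/
def Qoverlap (P0 : Measure ℝ) (S : Finset ℝ) (n : ℕ) (lam : ℝ) (ω : CavΩ n) : ℝ :=
  (1 / n : ℝ) * ∑ i : Fin n, (bcoef P0 S n lam ω i) ^ 2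

/-- The cavity field
`y(x) = (√λ/(√2 n)) Σ_i Z″_i x_i² + (√λ/n) Σ_{i<j} x_i x_j Z̃_{ij}
  + (λ/2)((x·X)² − (1/2)(x·x)²)`. -/
def yfield (n : ℕ) (lam : ℝ) (ω : CavΩ n) (x : Fin n → ℝ) : ℝ :=
  Real.sqrt lam / (Real.sqrt 2 * n) * ∑ i : Fin n, ω.2.2.2.1 i.castSucc * (x i) ^ 2
    + Real.sqrt lam / n *
        ∑ p ∈ pairs n, x p.1 * x p.2 * ω.2.2.2.2 (p.1.castSucc, p.2.castSucc)
    + lam / 2 * ((ndot n x (fun i => ω.1 i.castSucc)) ^ 2 - 1 / 2 * (ndot n x x) ^ 2)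

/-- The function `x ↦ Σ_{σ∈S} P0(σ) exp(σ̄ z(x) + σ̄² s(x))`. -/
def fzs (P0 : Measure ℝ) (S : Finset ℝ) (n : ℕ) (lam : ℝ) (ω : CavΩ n)
    (x : Fin n → ℝ) : ℝ :=
  ∑ σ ∈ S, (P0 {σ}).toReal *
    Real.exp (sigbar n ω σ * zfield n lam ω x + (sigbar n ω σ) ^ 2 * sfield n lam x)

/-- `U = ⟨Σ_{σ∈S} P0(σ) exp(σ̄ z(x) + σ̄² s(x))⟩_{n,ε}`. -/
def Ucav (P0 : Measure ℝ) (S : Finset ℝ) (n : ℕ) (lam : ℝ) (ω : CavΩ n) : ℝ :=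
  gibbs P0 S n lam ω (fzs P0 S n lam ω)

/-- `V = Σ_{σ∈S} P0(σ) exp(σ̄ √(λ/n) Σ_i b_i Z′_i + λQ X′ σ̄ − (λQ/2) σ̄²)`. -/
def Vcav (P0 : Measure ℝ) (S : Finset ℝ) (n : ℕ) (lam : ℝ) (ω : CavΩ n) : ℝ :=
  ∑ σ ∈ S, (P0 {σ}).toReal *
    Real.exp (sigbar n ω σ * Real.sqrt (lam / n) *
        (∑ i : Fin n, bcoef P0 S n lam ω i * ω.2.1 (i.castSucc, Fin.last n))
      + lam * Qoverlap P0 S n lam ω * ω.1 (Fin.last n) * sigbar n ω σ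
      - lam * Qoverlap P0 S n lam ω / 2 * (sigbar n ω σ) ^ 2)

/-! ### Conditional averages on a finite product space -/

/-- The configuration that agrees with `X` on the revealed set `L` and with `x` elsewhere. -/
def mix {n : ℕ} (L : Fin n → Bool) (X x : Fin n → ℝ) : Fin n → ℝ :=
  fun i => if L i then X i else x i

/-- The normalization of `gavg`. -/
def gnorm (P0 : Measure ℝ) (S : Finset ℝ) {n : ℕ} (g : (Fin n → ℝ) → ℝ) (L : Fin n → Bool)
    (X : Fin n → ℝ) : ℝ :=
  ∑ x ∈ confs S n, weight P0 n x * g (mix L X x)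

/-- The average of `f` under the law with density proportional to `g` with respect to `P0⊗n`,
conditioned on the coordinates of `X` in `L`. -/
def gavg (P0 : Measure ℝ) (S : Finset ℝ) {n : ℕ} (g : (Fin n → ℝ) → ℝ) (L : Fin n → Bool)
    (X : Fin n → ℝ) (f : (Fin n → ℝ) → ℝ) : ℝ :=
  (∑ x ∈ confs S n, weight P0 n x * f (mix L X x) * g (mix L X x)) / gnorm P0 S g L X

theorem mix_mem_confs {S : Finset ℝ} {n : ℕ} (L : Fin n → Bool) {X x : Fin n → ℝ}
    (hX : X ∈ confs S n) (hx : x ∈ confs S n) : mix L X x ∈ confs S n := by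
  simp only [confs, Fintype.mem_piFinset, mix] at *
  intro i
  split_ifs
  exacts [hX i, hx i]

theorem mix_mix_left {n : ℕ} (L : Fin n → Bool) (X x y : Fin n → ℝ) :
    mix L (mix L X x) y = mix L X y := by
  ext i; simp only [mix]; split_ifs <;> rfl

theorem mix_mix_swap {n : ℕ} (L : Fin n → Bool) (X x : Fin n → ℝ) :
    mix L (mix L X x) (mix L x X) = X := by
  ext i; simp only [mix]; split_ifs <;> rfl

theorem mix_false {n : ℕ} (X x : Fin n → ℝ) : mix (fun _ => false) X x = x := by
  ext i; simp [mix]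

theorem weight_nonneg (P0 : Measure ℝ) {n : ℕ} (x : Fin n → ℝ) : 0 ≤ weight P0 n x :=
  Finset.prod_nonneg fun _ _ => ENNReal.toReal_nonneg

theorem weight_mix_mul_weight_mix (P0 : Measure ℝ) {n : ℕ} (L : Fin n → Bool)
    (x y : Fin n → ℝ) :
    weight P0 n (mix L x y) * weight P0 n (mix L y x) = weight P0 n x * weight P0 n y := by
  simp only [weight, mix, ← Finset.prod_mul_distrib]
  refine Finset.prod_congr rfl fun i _ => ?_
  split_ifs
  · rfl
  · ring

section Avg

variable {P0 : Measure ℝ} {S : Finset ℝ} {n : ℕ} {g : (Fin n → ℝ) → ℝ}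

theorem sum_weight (hS : ∑ σ ∈ S, (P0 {σ}).toReal = 1) : ∑ x ∈ confs S n, weight P0 n x = 1 := by
  have h := Finset.prod_univ_sum (fun _ : Fin n => S) (fun _ σ => (P0 {σ}).toReal)
  simp only [hS, Finset.prod_const_one] at h
  exact h.symm

theorem gnorm_pos (hS : ∑ σ ∈ S, (P0 {σ}).toReal = 1) (hg : ∀ x, 0 < g x) (L : Fin n → Bool)
    (X : Fin n → ℝ) : 0 < gnorm P0 S g L X := by
  have h0 : ∀ x ∈ confs S n, 0 ≤ weight P0 n x * g (mix L X x) := fun x _ =>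
    mul_nonneg (weight_nonneg P0 x) (hg _).le
  refine lt_of_le_of_ne (Finset.sum_nonneg h0) fun h => ?_
  have h1 := (Finset.sum_eq_zero_iff_of_nonneg h0).1 h.symm
  have h2 := sum_weight (n := n) hS
  rw [Finset.sum_eq_zero] at h2
  · exact zero_ne_one h2
  · intro x hx
    exact (mul_eq_zero.1 (h1 x hx)).resolve_right (hg _).ne'

theorem gnorm_mix (L : Fin n → Bool) (X x : Fin n → ℝ) :
    gnorm P0 S g L (mix L X x) = gnorm P0 S g L X := by
  simp only [gnorm, mix_mix_left]

theorem gavg_mix (L : Fin n → Bool) (X x : Fin n → ℝ) (f : (Fin n → ℝ) → ℝ) :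
    gavg P0 S g L (mix L X x) f = gavg P0 S g L X f := by
  simp only [gavg, gnorm_mix, mix_mix_left]

/-- The probability of a configuration under `gavg`. -/
def gprob (P0 : Measure ℝ) (S : Finset ℝ) {n : ℕ} (g : (Fin n → ℝ) → ℝ) (L : Fin n → Bool)
    (X x : Fin n → ℝ) : ℝ :=
  weight P0 n x * g (mix L X x) / gnorm P0 S g L X

theorem gavg_eq_sum (L : Fin n → Bool) (X : Fin n → ℝ) (f : (Fin n → ℝ) → ℝ) :
    gavg P0 S g L X f = ∑ x ∈ confs S n, gprob P0 S g L X x * f (mix L X x) := by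
  rw [gavg, Finset.sum_div]
  refine Finset.sum_congr rfl fun x _ => ?_
  rw [gprob]; ring

theorem gprob_nonneg (hS : ∑ σ ∈ S, (P0 {σ}).toReal = 1) (hg : ∀ x, 0 < g x) (L : Fin n → Bool)
    (X x : Fin n → ℝ) : 0 ≤ gprob P0 S g L X x :=
  div_nonneg (mul_nonneg (weight_nonneg P0 x) (hg _).le) (gnorm_pos hS hg L X).le

theorem sum_gprob (hS : ∑ σ ∈ S, (P0 {σ}).toReal = 1) (hg : ∀ x, 0 < g x) (L : Fin n → Bool)
    (X : Fin n → ℝ) : ∑ x ∈ confs S n, gprob P0 S g L X x = 1 := by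
  simp only [gprob]
  rw [← Finset.sum_div]
  exact div_self (gnorm_pos hS hg L X).ne'

theorem gavg_const (hS : ∑ σ ∈ S, (P0 {σ}).toReal = 1) (hg : ∀ x, 0 < g x) (L : Fin n → Bool)
    (X : Fin n → ℝ) (c : ℝ) : gavg P0 S g L X (fun _ => c) = c := by
  rw [gavg_eq_sum, ← Finset.sum_mul, sum_gprob hS hg, one_mul]

theorem gavg_congr {L : Fin n → Bool} {X : Fin n → ℝ} {f f' : (Fin n → ℝ) → ℝ}
    (h : ∀ x, f (mix L X x) = f' (mix L X x)) : gavg P0 S g L X f = gavg P0 S g L X f' := by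
  simp only [gavg, h]

theorem gavg_add (L : Fin n → Bool) (X : Fin n → ℝ) (f f' : (Fin n → ℝ) → ℝ) :
    gavg P0 S g L X (fun x => f x + f' x) = gavg P0 S g L X f + gavg P0 S g L X f' := by
  simp only [gavg_eq_sum, mul_add, Finset.sum_add_distrib]

theorem gavg_sub (L : Fin n → Bool) (X : Fin n → ℝ) (f f' : (Fin n → ℝ) → ℝ) :
    gavg P0 S g L X (fun x => f x - f' x) = gavg P0 S g L X f - gavg P0 S g L X f' := by
  simp only [gavg_eq_sum, mul_sub, Finset.sum_sub_distrib]

theorem gavg_const_mul (L : Fin n → Bool) (X : Fin n → ℝ) (c : ℝ) (f : (Fin n → ℝ) → ℝ) :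
    gavg P0 S g L X (fun x => c * f x) = c * gavg P0 S g L X f := by
  simp only [gavg_eq_sum, Finset.mul_sum]
  exact Finset.sum_congr rfl fun _ _ => by ring

theorem gavg_mul_const (L : Fin n → Bool) (X : Fin n → ℝ) (c : ℝ) (f : (Fin n → ℝ) → ℝ) :
    gavg P0 S g L X (fun x => f x * c) = gavg P0 S g L X f * c := by
  simp only [mul_comm _ c, gavg_const_mul]

theorem gavg_sum {ι : Type*} (s : Finset ι) (L : Fin n → Bool) (X : Fin n → ℝ)
    (f : ι → (Fin n → ℝ) → ℝ) :
    gavg P0 S g L X (fun x => ∑ i ∈ s, f i x) = ∑ i ∈ s, gavg P0 S g L X (f i) := by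
  simp only [gavg_eq_sum, Finset.mul_sum]
  exact Finset.sum_comm

theorem gavg_mono (hS : ∑ σ ∈ S, (P0 {σ}).toReal = 1) (hg : ∀ x, 0 < g x) (L : Fin n → Bool)
    {X : Fin n → ℝ} (hX : X ∈ confs S n) {f f' : (Fin n → ℝ) → ℝ}
    (h : ∀ x ∈ confs S n, f x ≤ f' x) : gavg P0 S g L X f ≤ gavg P0 S g L X f' := by
  simp only [gavg_eq_sum]
  exact Finset.sum_le_sum fun x hx =>
    mul_le_mul_of_nonneg_left (h _ (mix_mem_confs L hX hx)) (gprob_nonneg hS hg L X x)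

theorem abs_gavg_le (hS : ∑ σ ∈ S, (P0 {σ}).toReal = 1) (hg : ∀ x, 0 < g x) (L : Fin n → Bool)
    {X : Fin n → ℝ} (hX : X ∈ confs S n) {f : (Fin n → ℝ) → ℝ} {C : ℝ}
    (h : ∀ x ∈ confs S n, |f x| ≤ C) : |gavg P0 S g L X f| ≤ C := by
  rw [abs_le]
  constructor
  · rw [← gavg_const hS hg L X (-C)]
    exact gavg_mono hS hg L hX fun x hx => (abs_le.1 (h x hx)).1
  · rw [← gavg_const hS hg L X C]
    exact gavg_mono hS hg L hX fun x hx => (abs_le.1 (h x hx)).2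

theorem gavg_sub_gavg_sq (hS : ∑ σ ∈ S, (P0 {σ}).toReal = 1) (hg : ∀ x, 0 < g x)
    (L : Fin n → Bool) (X : Fin n → ℝ) (f : (Fin n → ℝ) → ℝ) :
    gavg P0 S g L X (fun x => (f x - gavg P0 S g L X f) ^ 2)
      = gavg P0 S g L X (fun x => f x ^ 2) - gavg P0 S g L X f ^ 2 := by
  set m := gavg P0 S g L X f with hm
  have : (fun x => (f x - m) ^ 2) = fun x => (f x ^ 2 + (-2 * m) * f x) + m ^ 2 := by
    ext x; ring
  rw [this, gavg_add, gavg_add, gavg_const_mul, gavg_const hS hg, ← hm]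
  ring

theorem sq_gavg_le (hS : ∑ σ ∈ S, (P0 {σ}).toReal = 1) (hg : ∀ x, 0 < g x) (L : Fin n → Bool)
    {X : Fin n → ℝ} (hX : X ∈ confs S n) (f : (Fin n → ℝ) → ℝ) :
    gavg P0 S g L X f ^ 2 ≤ gavg P0 S g L X (fun x => f x ^ 2) := by
  have h := gavg_sub_gavg_sq hS hg L X f
  have h0 : 0 ≤ gavg P0 S g L X (fun x => (f x - gavg P0 S g L X f) ^ 2) := by
    rw [← gavg_const hS hg L X 0]
    exact gavg_mono hS hg L hX fun x _ => sq_nonneg _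
  linarith

/-- Tower property (unnormalized): averaging a function of the revealed coordinates and of a
fresh sample drawn given a larger set `L'` of revealed coordinates does not change its mean. -/
theorem sum_gavg_tower (hS : ∑ σ ∈ S, (P0 {σ}).toReal = 1) (hg : ∀ x, 0 < g x)
    {L L' : Fin n → Bool} (hLL : ∀ i, L i = true → L' i = true) {X : Fin n → ℝ}
    (F : (Fin n → ℝ) → (Fin n → ℝ) → ℝ) (hF : ∀ y x z, F y (mix L' x z) = F y x) :
    ∑ x ∈ confs S n, weight P0 n x *
        gavg P0 S g L' (mix L X x) (fun y => F y (mix L X x)) * g (mix L X x)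
      = ∑ x ∈ confs S n, weight P0 n x * F (mix L X x) (mix L X x) * g (mix L X x) := by
  have key : ∀ x y : Fin n → ℝ, mix L X (mix L' x y) = mix L' (mix L X x) y := by
    intro x y; ext i; simp only [mix]
    by_cases h : L i = true
    · simp [h, hLL i h]
    · simp [h]
  have e1 : ∑ x ∈ confs S n, weight P0 n x *
        gavg P0 S g L' (mix L X x) (fun y => F y (mix L X x)) * g (mix L X x)
      = ∑ p ∈ confs S n ×ˢ confs S n, weight P0 n p.1 * weight P0 n p.2 * g (mix L X p.1) *
          g (mix L' (mix L X p.1) p.2) * F (mix L' (mix L X p.1) p.2) (mix L X p.1)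
            / gnorm P0 S g L' (mix L X p.1) := by
    rw [Finset.sum_product]
    refine Finset.sum_congr rfl fun x _ => ?_
    rw [gavg, Finset.sum_div, Finset.mul_sum, Finset.sum_mul]
    exact Finset.sum_congr rfl fun y _ => by ring
  have e2 : ∑ x ∈ confs S n, weight P0 n x * F (mix L X x) (mix L X x) * g (mix L X x)
      = ∑ p ∈ confs S n ×ˢ confs S n, weight P0 n p.1 * weight P0 n p.2 * g (mix L X p.1) *
          g (mix L' (mix L X p.1) p.2) * F (mix L X p.1) (mix L X p.1)
            / gnorm P0 S g L' (mix L X p.1) := by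
    rw [Finset.sum_product]
    refine Finset.sum_congr rfl fun x _ => ?_
    have hpos := gnorm_pos hS hg L' (mix L X x)
    have : weight P0 n x * F (mix L X x) (mix L X x) * g (mix L X x)
        = weight P0 n x * F (mix L X x) (mix L X x) * g (mix L X x)
          * gnorm P0 S g L' (mix L X x) / gnorm P0 S g L' (mix L X x) := by
      field_simp
    rw [this]
    conv_lhs => enter [1, 2]; rw [gnorm]
    rw [Finset.mul_sum, Finset.sum_div]
    exact Finset.sum_congr rfl fun y _ => by ring
  rw [e1, e2]
  refine Finset.sum_nbij' (fun p => (mix L' p.1 p.2, mix L' p.2 p.1))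
    (fun p => (mix L' p.1 p.2, mix L' p.2 p.1)) ?_ ?_ ?_ ?_ ?_
  · intro p hp
    rw [Finset.mem_product] at hp ⊢
    exact ⟨mix_mem_confs L' hp.1 hp.2, mix_mem_confs L' hp.2 hp.1⟩
  · intro p hp
    rw [Finset.mem_product] at hp ⊢
    exact ⟨mix_mem_confs L' hp.1 hp.2, mix_mem_confs L' hp.2 hp.1⟩
  · intro p _; simp only [mix_mix_swap]
  · intro p _; simp only [mix_mix_swap]
  · rintro ⟨x, y⟩ _
    simp only [key, gnorm_mix, mix_mix_left, hF, weight_mix_mul_weight_mix]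
    have : mix L' (mix L X x) (mix L' y x) = mix L X x := by
      rw [← key]
      congr 1
      ext i; simp only [mix]; split_ifs <;> rfl
    rw [this]
    ring

end Avg

section Overlap

variable {P0 : Measure ℝ} {S : Finset ℝ} {n : ℕ} {g : (Fin n → ℝ) → ℝ} {K : ℝ}

theorem gavg_tower (hS : ∑ σ ∈ S, (P0 {σ}).toReal = 1) (hg : ∀ x, 0 < g x)
    {L L' : Fin n → Bool} (hLL : ∀ i, L i = true → L' i = true) (X : Fin n → ℝ)
    (F : (Fin n → ℝ) → (Fin n → ℝ) → ℝ) (hF : ∀ y x z, F y (mix L' x z) = F y x) :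
    gavg P0 S g L X (fun x => gavg P0 S g L' x (fun y => F y x))
      = gavg P0 S g L X (fun x => F x x) := by
  rw [gavg, sum_gavg_tower hS hg hLL F hF, gavg]

/-- The mean of `F` under the unnormalized law with density `g` with respect to `P0⊗n`. -/
def gmean (P0 : Measure ℝ) (S : Finset ℝ) {n : ℕ} (g : (Fin n → ℝ) → ℝ)
    (F : (Fin n → ℝ) → ℝ) : ℝ :=
  ∑ X ∈ confs S n, weight P0 n X * F X * g X

theorem gmean_gavg (hS : ∑ σ ∈ S, (P0 {σ}).toReal = 1) (hg : ∀ x, 0 < g x) (L : Fin n → Bool)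
    (F : (Fin n → ℝ) → (Fin n → ℝ) → ℝ) (hF : ∀ y x z, F y (mix L x z) = F y x) :
    gmean P0 S g (fun X => gavg P0 S g L X (fun y => F y X)) = gmean P0 S g (fun X => F X X) := by
  have h := sum_gavg_tower (P0 := P0) (S := S) (g := g) hS hg (L := fun _ => false) (L' := L)
    (by simp) (X := 0) F hF
  simpa only [mix_false, gmean] using h

theorem gmean_mono (hg : ∀ x, 0 < g x) {F F' : (Fin n → ℝ) → ℝ}
    (h : ∀ x ∈ confs S n, F x ≤ F' x) : gmean P0 S g F ≤ gmean P0 S g F' :=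
  Finset.sum_le_sum fun x hx => mul_le_mul_of_nonneg_right
    (mul_le_mul_of_nonneg_left (h x hx) (weight_nonneg P0 x)) (hg x).le

theorem gmean_add (F F' : (Fin n → ℝ) → ℝ) :
    gmean P0 S g (fun x => F x + F' x) = gmean P0 S g F + gmean P0 S g F' := by
  simp only [gmean, mul_add, add_mul, Finset.sum_add_distrib]

theorem gmean_sub (F F' : (Fin n → ℝ) → ℝ) :
    gmean P0 S g (fun x => F x - F' x) = gmean P0 S g F - gmean P0 S g F' := by
  simp only [gmean, mul_sub, sub_mul, Finset.sum_sub_distrib]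

theorem gmean_const_mul (c : ℝ) (F : (Fin n → ℝ) → ℝ) :
    gmean P0 S g (fun x => c * F x) = c * gmean P0 S g F := by
  simp only [gmean, Finset.mul_sum]
  exact Finset.sum_congr rfl fun _ _ => by ring

theorem gmean_sum {ι : Type*} (s : Finset ι) (F : ι → (Fin n → ℝ) → ℝ) :
    gmean P0 S g (fun x => ∑ i ∈ s, F i x) = ∑ i ∈ s, gmean P0 S g (F i) := by
  simp only [gmean, Finset.mul_sum, Finset.sum_mul]
  exact Finset.sum_comm

/-- The covariance of the coordinates `i` and `j` under `gavg`. -/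
def gcov (P0 : Measure ℝ) (S : Finset ℝ) {n : ℕ} (g : (Fin n → ℝ) → ℝ) (L : Fin n → Bool)
    (X : Fin n → ℝ) (i j : Fin n) : ℝ :=
  gavg P0 S g L X (fun x => x i * x j)
    - gavg P0 S g L X (fun x => x i) * gavg P0 S g L X (fun x => x j)

theorem gcov_eq_zero {L : Fin n → Bool} {j : Fin n} (hj : L j = true) (X : Fin n → ℝ)
    (hS : ∑ σ ∈ S, (P0 {σ}).toReal = 1) (hg : ∀ x, 0 < g x) (i : Fin n) :
    gcov P0 S g L X i j = 0 := by
  have h1 : gavg P0 S g L X (fun x => x i * x j) = gavg P0 S g L X (fun x => x i * X j) :=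
    gavg_congr fun x => by simp [mix, hj]
  have h2 : gavg P0 S g L X (fun x => x j) = gavg P0 S g L X (fun _ => X j) :=
    gavg_congr fun x => by simp [mix, hj]
  rw [gcov, h1, h2, gavg_mul_const, gavg_const hS hg, sub_self]

theorem abs_apply_le_of_mem_confs (hSK : ∀ σ ∈ S, |σ| ≤ K) {x : Fin n → ℝ}
    (hx : x ∈ confs S n) (i : Fin n) : |x i| ≤ K :=
  hSK _ (Fintype.mem_piFinset.1 hx i)

/-- Revealing one more coordinate `j` increases the mean square of the conditional mean of `x i`
by at least a multiple of the squared covariance of `x i` and `x j`. -/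
theorem gcov_sq_le (hS : ∑ σ ∈ S, (P0 {σ}).toReal = 1) (hg : ∀ x, 0 < g x)
    (hSK : ∀ σ ∈ S, |σ| ≤ K) (L : Fin n → Bool) (i j : Fin n) {X : Fin n → ℝ}
    (hX : X ∈ confs S n) :
    gcov P0 S g L X i j ^ 2 ≤ K ^ 2 *
      (gavg P0 S g L X (fun x => gavg P0 S g (Function.update L j true) x (fun y => y i) ^ 2)
        - gavg P0 S g L X (fun y => y i) ^ 2) := by
  set L' := Function.update L j true with hL'
  have hLL : ∀ k, L k = true → L' k = true := by
    intro k hk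
    by_cases h : k = j
    · subst h; simp [hL']
    · simp [hL', h, hk]
  have hj : L' j = true := by simp [hL']
  set b' : (Fin n → ℝ) → ℝ := fun x => gavg P0 S g L' x (fun y => y i) with hb'
  have h1 : gavg P0 S g L X b' = gavg P0 S g L X (fun y => y i) :=
    gavg_tower hS hg hLL X (fun y _ => y i) (fun _ _ _ => rfl)
  have h2 : gavg P0 S g L X (fun x => b' x * x j) = gavg P0 S g L X (fun y => y i * y j) := by
    have := gavg_tower (P0 := P0) (S := S) hS hg hLL X (fun y x => y i * x j)
      (fun y x z => by simp [mix, hj])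
    simpa only [gavg_mul_const] using this
  have h3 : gcov P0 S g L X i j
      = gavg P0 S g L X (fun x => (b' x - gavg P0 S g L X b') * x j) := by
    simp only [sub_mul, gavg_sub, gavg_const_mul, h2, h1, gcov]
  rw [h3, ← h1]
  refine (sq_gavg_le hS hg L hX _).trans ?_
  rw [← gavg_sub_gavg_sq hS hg L X b', ← gavg_const_mul]
  refine gavg_mono hS hg L hX fun x hx => ?_
  rw [mul_pow, mul_comm]
  exact mul_le_mul_of_nonneg_right
    (sq_le_sq' (abs_le.1 (abs_apply_le_of_mem_confs hSK hx j)).1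
      (abs_le.1 (abs_apply_le_of_mem_confs hSK hx j)).2) (sq_nonneg _)

theorem gmean_gcov_sq_le (hS : ∑ σ ∈ S, (P0 {σ}).toReal = 1) (hg : ∀ x, 0 < g x)
    (hSK : ∀ σ ∈ S, |σ| ≤ K) (L : Fin n → Bool) (i j : Fin n) :
    gmean P0 S g (fun X => gcov P0 S g L X i j ^ 2) ≤ K ^ 2 *
      (gmean P0 S g (fun X => gavg P0 S g (Function.update L j true) X (fun y => y i) ^ 2)
        - gmean P0 S g (fun X => gavg P0 S g L X (fun y => y i) ^ 2)) := by
  refine (gmean_mono hg fun X hX => gcov_sq_le hS hg hSK L i j hX).trans_eq ?_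
  rw [gmean_const_mul, gmean_sub]
  rw [gmean_gavg hS hg L
    (fun x _ => gavg P0 S g (Function.update L j true) x (fun y => y i) ^ 2) (fun _ _ _ => rfl)]

/-- The normalized squared norm of the conditional mean. -/
def goverlap (P0 : Measure ℝ) (S : Finset ℝ) {n : ℕ} (g : (Fin n → ℝ) → ℝ) (L : Fin n → Bool)
    (X : Fin n → ℝ) : ℝ :=
  (1 / n : ℝ) * ∑ i : Fin n, gavg P0 S g L X (fun x => x i) ^ 2

/-- The averaged squared covariance. -/
def gcovSq (P0 : Measure ℝ) (S : Finset ℝ) {n : ℕ} (g : (Fin n → ℝ) → ℝ) (L : Fin n → Bool)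
    (X : Fin n → ℝ) : ℝ :=
  (1 / n : ℝ) ^ 2 * ∑ i, ∑ j, gcov P0 S g L X i j ^ 2

theorem goverlap_mix (L : Fin n → Bool) (X x : Fin n → ℝ) :
    goverlap P0 S g L (mix L X x) = goverlap P0 S g L X := by
  simp only [goverlap, gavg_mix]

theorem ndot_sub_sq (x a : Fin n → ℝ) (q : ℝ) :
    (ndot n x a - q) ^ 2 = (1 / n : ℝ) ^ 2 * ∑ i, ∑ j, (x i * x j) * (a i * a j)
      - 2 * q * ((1 / n : ℝ) * ∑ i, x i * a i) + q ^ 2 := by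
  have : (∑ i, x i * a i) ^ 2 = ∑ i, ∑ j, (x i * x j) * (a i * a j) := by
    rw [sq, Finset.sum_mul_sum]
    exact Finset.sum_congr rfl fun i _ => Finset.sum_congr rfl fun j _ => by ring
  rw [← this, ndot]; ring

theorem gavg_ndot_sub_sq (hS : ∑ σ ∈ S, (P0 {σ}).toReal = 1) (hg : ∀ x, 0 < g x)
    (L : Fin n → Bool) (X a : Fin n → ℝ) (q : ℝ) :
    gavg P0 S g L X (fun x => (ndot n x a - q) ^ 2)
      = (1 / n : ℝ) ^ 2 * ∑ i, ∑ j, gavg P0 S g L X (fun x => x i * x j) * (a i * a j)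
        - 2 * q * ((1 / n : ℝ) * ∑ i, gavg P0 S g L X (fun x => x i) * a i) + q ^ 2 := by
  simp only [ndot_sub_sq, gavg_add, gavg_sub, gavg_const_mul, gavg_sum, gavg_mul_const,
    gavg_const hS hg]

theorem goverlap_sq (L : Fin n → Bool) (X : Fin n → ℝ) :
    goverlap P0 S g L X ^ 2 = (1 / n : ℝ) ^ 2 * ∑ i, ∑ j,
      gavg P0 S g L X (fun x => x i) ^ 2 * gavg P0 S g L X (fun x => x j) ^ 2 := by
  rw [goverlap, mul_pow, sq (∑ i, _), Finset.sum_mul_sum]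

theorem abs_le_add_sq_div {u δ : ℝ} (hδ : 0 < δ) : |u| ≤ δ + u ^ 2 / δ := by
  have : |u| * δ ≤ (δ + u ^ 2 / δ) * δ := by
    rw [add_mul, div_mul_cancel₀ _ hδ.ne', ← sq_abs u]
    nlinarith [sq_nonneg (|u| - δ), abs_nonneg u]
  exact le_of_mul_le_mul_right this hδ

theorem mean_pair_le (hn : 0 < n) {δ : ℝ} (hδ : 0 < δ) (c : Fin n → Fin n → ℝ) :
    (1 / n : ℝ) ^ 2 * ∑ i, ∑ j, |c i j|
      ≤ δ + ((1 / n : ℝ) ^ 2 * ∑ i, ∑ j, c i j ^ 2) / δ := by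
  have h : ∑ i, ∑ j, |c i j| ≤ ∑ i, ∑ j, (δ + c i j ^ 2 / δ) :=
    Finset.sum_le_sum fun i _ => Finset.sum_le_sum fun j _ => abs_le_add_sq_div hδ
  refine (mul_le_mul_of_nonneg_left h (by positivity)).trans_eq ?_
  simp only [Finset.sum_add_distrib, Finset.sum_const, Finset.card_univ, Fintype.card_fin,
    nsmul_eq_mul, ← Finset.sum_div]
  have : (n : ℝ) ≠ 0 := by positivity
  field_simp

theorem abs_mean_le (hS : ∑ σ ∈ S, (P0 {σ}).toReal = 1) (hg : ∀ x, 0 < g x)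
    (hSK : ∀ σ ∈ S, |σ| ≤ K) (L : Fin n → Bool) {X : Fin n → ℝ} (hX : X ∈ confs S n)
    (i : Fin n) : |gavg P0 S g L X (fun x => x i)| ≤ K :=
  abs_gavg_le hS hg L hX fun _ hx => abs_apply_le_of_mem_confs hSK hx i

theorem gavg_ndot_mean_sub_sq_le (hS : ∑ σ ∈ S, (P0 {σ}).toReal = 1) (hg : ∀ x, 0 < g x)
    (hSK : ∀ σ ∈ S, |σ| ≤ K) (L : Fin n → Bool) {X : Fin n → ℝ} (hX : X ∈ confs S n)
    (hn : 0 < n) {δ : ℝ} (hδ : 0 < δ) :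
    gavg P0 S g L X (fun x => (ndot n x (fun i => gavg P0 S g L X (fun x => x i))
        - goverlap P0 S g L X) ^ 2)
      ≤ gcovSq P0 S g L X + 2 * K ^ 2 * (δ + gcovSq P0 S g L X / δ) := by
  set b : Fin n → ℝ := fun i => gavg P0 S g L X (fun x => x i) with hb
  have hbK : ∀ i, |b i| ≤ K := abs_mean_le hS hg hSK L hX
  have hK : ∀ i j, |b i * b j| ≤ K ^ 2 := fun i j => by
    rw [abs_mul, sq]
    exact mul_le_mul (hbK i) (hbK j) (abs_nonneg _) ((abs_nonneg _).trans (hbK i))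
  have hc0 : 0 ≤ gcovSq P0 S g L X := by unfold gcovSq; positivity
  have hq : (1 / n : ℝ) * ∑ i, b i * b i = goverlap P0 S g L X := by
    simp only [goverlap, ← sq, hb]
  have hq2 := goverlap_sq (P0 := P0) (S := S) (g := g) L X
  have e : gavg P0 S g L X (fun x => (ndot n x b - goverlap P0 S g L X) ^ 2)
      = (1 / n : ℝ) ^ 2 * ∑ i, ∑ j, gcov P0 S g L X i j * (b i * b j) := by
    rw [gavg_ndot_sub_sq hS hg, hq]
    have : ∑ i, ∑ j, gcov P0 S g L X i j * (b i * b j)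
        = (∑ i, ∑ j, gavg P0 S g L X (fun x => x i * x j) * (b i * b j))
          - ∑ i, ∑ j, b i ^ 2 * b j ^ 2 := by
      simp only [← Finset.sum_sub_distrib]
      refine Finset.sum_congr rfl fun i _ => Finset.sum_congr rfl fun j _ => ?_
      rw [gcov]; ring
    rw [this, mul_sub, ← hq2]; ring
  rw [e]
  have h1 : ∑ i, ∑ j, gcov P0 S g L X i j * (b i * b j)
      ≤ ∑ i, ∑ j, K ^ 2 * |gcov P0 S g L X i j| := by
    refine Finset.sum_le_sum fun i _ => Finset.sum_le_sum fun j _ => ?_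
    refine (le_abs_self _).trans ?_
    rw [abs_mul, mul_comm]
    exact mul_le_mul_of_nonneg_right (hK i j) (abs_nonneg _)
  have h2 := mean_pair_le hn hδ (gcov P0 S g L X)
  simp only [← Finset.mul_sum] at h1
  have h3 := mul_le_mul_of_nonneg_left h1 (by positivity : (0 : ℝ) ≤ (1 / n : ℝ) ^ 2)
  have h4 := mul_le_mul_of_nonneg_left h2 (sq_nonneg K)
  have h5 : 0 ≤ K ^ 2 * (δ + gcovSq P0 S g L X / δ) := by positivity
  rw [gcovSq] at *
  nlinarith

theorem gavg_gavg_ndot_sub_sq_le (hS : ∑ σ ∈ S, (P0 {σ}).toReal = 1) (hg : ∀ x, 0 < g x)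
    (hSK : ∀ σ ∈ S, |σ| ≤ K) (L : Fin n → Bool) {X : Fin n → ℝ} (hX : X ∈ confs S n)
    (hn : 0 < n) {δ : ℝ} (hδ : 0 < δ) :
    gavg P0 S g L X (fun y => gavg P0 S g L X (fun x =>
        (ndot n x y - goverlap P0 S g L X) ^ 2))
      ≤ gcovSq P0 S g L X + 2 * K ^ 2 * (δ + gcovSq P0 S g L X / δ) := by
  set b : Fin n → ℝ := fun i => gavg P0 S g L X (fun x => x i) with hb
  have hbK : ∀ i, |b i| ≤ K := abs_mean_le hS hg hSK L hX
  have hK : ∀ i j, |b i * b j| ≤ K ^ 2 := fun i j => by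
    rw [abs_mul, sq]
    exact mul_le_mul (hbK i) (hbK j) (abs_nonneg _) ((abs_nonneg _).trans (hbK i))
  have hq : (1 / n : ℝ) * ∑ i, b i * b i = goverlap P0 S g L X := by
    simp only [goverlap, ← sq, hb]
  have hq2 := goverlap_sq (P0 := P0) (S := S) (g := g) L X
  have e : gavg P0 S g L X (fun y => gavg P0 S g L X (fun x =>
        (ndot n x y - goverlap P0 S g L X) ^ 2))
      = (1 / n : ℝ) ^ 2 * ∑ i, ∑ j,
          (gcov P0 S g L X i j ^ 2 + 2 * (gcov P0 S g L X i j * (b i * b j))) := by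
    simp only [gavg_ndot_sub_sq hS hg, gavg_add, gavg_sub, gavg_const_mul, gavg_sum,
      gavg_const hS hg]
    change _ - 2 * goverlap P0 S g L X * (1 / (n : ℝ) * ∑ i, b i * b i) + _ = _
    rw [hq]
    have : ∑ i, ∑ j, (gcov P0 S g L X i j ^ 2 + 2 * (gcov P0 S g L X i j * (b i * b j)))
        = (∑ i, ∑ j, gavg P0 S g L X (fun x => x i * x j) * gavg P0 S g L X (fun x => x i * x j))
          - ∑ i, ∑ j, b i ^ 2 * b j ^ 2 := by
      simp only [← Finset.sum_sub_distrib]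
      refine Finset.sum_congr rfl fun i _ => Finset.sum_congr rfl fun j _ => ?_
      rw [gcov]; ring
    rw [this, mul_sub, ← hq2]; ring
  rw [e]
  have h1 : ∑ i, ∑ j, (gcov P0 S g L X i j ^ 2 + 2 * (gcov P0 S g L X i j * (b i * b j)))
      ≤ ∑ i, ∑ j, (gcov P0 S g L X i j ^ 2 + 2 * K ^ 2 * |gcov P0 S g L X i j|) := by
    refine Finset.sum_le_sum fun i _ => Finset.sum_le_sum fun j _ => ?_
    rw [mul_assoc]
    refine add_le_add le_rfl (mul_le_mul_of_nonneg_left ?_ zero_le_two)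
    refine (le_abs_self _).trans ?_
    rw [abs_mul, mul_comm]
    exact mul_le_mul_of_nonneg_right (hK i j) (abs_nonneg _)
  have h2 := mean_pair_le hn hδ (gcov P0 S g L X)
  simp only [Finset.sum_add_distrib, ← Finset.mul_sum] at h1 ⊢
  have h3 := mul_le_mul_of_nonneg_left h1 (by positivity : (0 : ℝ) ≤ (1 / n : ℝ) ^ 2)
  have h4 := mul_le_mul_of_nonneg_left h2 (by positivity : 0 ≤ 2 * K ^ 2)
  rw [gcovSq]
  nlinarith

/-- The total deviation of the overlaps from their mean. -/
def gdev (P0 : Measure ℝ) (S : Finset ℝ) {n : ℕ} (g : (Fin n → ℝ) → ℝ) (L : Fin n → Bool)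
    (X : Fin n → ℝ) : ℝ :=
  gavg P0 S g L X (fun y => gavg P0 S g L X (fun x => |ndot n x y - goverlap P0 S g L X|))
    + 4 * gavg P0 S g L X (fun x => |ndot n x X - goverlap P0 S g L X|)
    + 2 * gavg P0 S g L X (fun x => |ndot n x (fun i => gavg P0 S g L X (fun x => x i))
        - goverlap P0 S g L X|)

theorem gmean_gdev_le (hS : ∑ σ ∈ S, (P0 {σ}).toReal = 1) (hg : ∀ x, 0 < g x)
    (hSK : ∀ σ ∈ S, |σ| ≤ K) (L : Fin n → Bool) (hn : 0 < n) {η : ℝ} (hη : 0 < η) :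
    gmean P0 S g (gdev P0 S g L)
      ≤ (7 + 14 * K ^ 2) * η * gmean P0 S g (fun _ => 1)
        + 7 / η * (1 + 2 * K ^ 2 / η ^ 2) * gmean P0 S g (gcovSq P0 S g L) := by
  set q := goverlap P0 S g L with hq
  set B : (Fin n → ℝ) → ℝ := fun X =>
    gcovSq P0 S g L X + 2 * K ^ 2 * (η ^ 2 + gcovSq P0 S g L X / η ^ 2) with hB
  have habs : ∀ {X : Fin n → ℝ} (_ : X ∈ confs S n) (f : (Fin n → ℝ) → ℝ),
      gavg P0 S g L X (fun x => |f x|) ≤ η + 1 / η * gavg P0 S g L X (fun x => f x ^ 2) := by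
    intro X hX f
    rw [← gavg_const_mul, ← gavg_const hS hg L X η, ← gavg_add, gavg_const hS hg]
    refine gavg_mono hS hg L hX fun x _ => (abs_le_add_sq_div hη).trans_eq ?_
    ring
  have hG : ∀ X ∈ confs S n, gdev P0 S g L X
      ≤ 7 * η + 3 / η * B X
        + 4 / η * gavg P0 S g L X (fun x => (ndot n x X - q X) ^ 2) := by
    intro X hX
    have h1 : gavg P0 S g L X (fun y => gavg P0 S g L X (fun x => |ndot n x y - q X|))
        ≤ η + 1 / η * B X := by
      refine (gavg_mono hS hg L hX fun y _ => habs hX _).trans ?_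
      rw [gavg_add, gavg_const hS hg, gavg_const_mul]
      gcongr
      exact gavg_gavg_ndot_sub_sq_le hS hg hSK L hX hn (by positivity)
    have h2 := habs hX (fun x => ndot n x X - q X)
    have h3 : gavg P0 S g L X (fun x => |ndot n x (fun i => gavg P0 S g L X (fun x => x i))
        - q X|) ≤ η + 1 / η * B X := by
      refine (habs hX _).trans ?_
      gcongr
      exact gavg_ndot_mean_sub_sq_le hS hg hSK L hX hn (by positivity)
    calc gdev P0 S g L X ≤ (η + 1 / η * B X)
          + 4 * (η + 1 / η * gavg P0 S g L X (fun x => (ndot n x X - q X) ^ 2))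
          + 2 * (η + 1 / η * B X) := by
          unfold gdev
          linarith
      _ = _ := by ring
  refine (gmean_mono hg hG).trans ?_
  have hT : gmean P0 S g (fun X => gavg P0 S g L X (fun x => (ndot n x X - q X) ^ 2))
      ≤ gmean P0 S g B := by
    rw [← gmean_gavg hS hg L (fun y X => gavg P0 S g L X (fun x => (ndot n x y - q X) ^ 2))
      (fun y x z => by simp only [gavg_mix, hq, goverlap_mix])]
    exact gmean_mono hg fun X hX =>
      gavg_gavg_ndot_sub_sq_le hS hg hSK L hX hn (by positivity)
  have hBm : gmean P0 S g B = 2 * K ^ 2 * η ^ 2 * gmean P0 S g (fun _ => 1)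
      + (1 + 2 * K ^ 2 / η ^ 2) * gmean P0 S g (gcovSq P0 S g L) := by
    rw [← gmean_const_mul, ← gmean_const_mul, ← gmean_add]
    congr 1
    ext X
    simp only [hB]; ring
  have h7 : gmean P0 S g (fun _ => 7 * η) = 7 * η * gmean P0 S g (fun _ => 1) := by
    rw [← gmean_const_mul]; simp only [mul_one]
  rw [gmean_add, gmean_add, h7, gmean_const_mul, gmean_const_mul]
  calc _ ≤ 7 * η * gmean P0 S g (fun _ => 1) + 3 / η * gmean P0 S g B
        + 4 / η * gmean P0 S g B := by gcongr
    _ = _ := by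
      rw [hBm]; field_simp; ring

end Overlap

/-! ### Exponential moments and translations of standard Gaussian vectors -/

instance : IsProbabilityMeasure stdGauss := by unfold stdGauss; infer_instance

section Gaussian

variable {κ : Type*} [Fintype κ]

/-- The law of a standard Gaussian vector. -/
def gaussVec (κ : Type*) [Fintype κ] : Measure (κ → ℝ) := Measure.pi fun _ : κ => stdGauss

instance : IsProbabilityMeasure (gaussVec κ) := by unfold gaussVec; infer_instance

theorem exp_sum_eq_prod (c u : κ → ℝ) :
    Real.exp (∑ k, c k * u k) = ∏ k, Real.exp (c k * u k) := Real.exp_sum _ _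

theorem integrable_exp_linear (c : κ → ℝ) :
    Integrable (fun u => Real.exp (∑ k, c k * u k)) (gaussVec κ) := by
  simp only [exp_sum_eq_prod]
  exact Integrable.fintype_prod (f := fun k z => Real.exp (c k * z))
    fun k => integrable_exp_mul_gaussianReal (c k)

theorem integral_exp_linear (c : κ → ℝ) :
    ∫ u, Real.exp (∑ k, c k * u k) ∂gaussVec κ = Real.exp (∑ k, c k ^ 2 / 2) := by
  simp only [exp_sum_eq_prod]
  rw [gaussVec, integral_fintype_prod_eq_prod (fun k z => Real.exp (c k * z)), Real.exp_sum]
  refine Finset.prod_congr rfl fun k _ => ?_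
  have h := congrFun (mgf_id_gaussianReal (μ := 0) (v := 1)) (c k)
  simpa [mgf, stdGauss] using h

/-- The exponential of a Gaussian linear form, normalized to have mean `exp m`. -/
def wexp (a : κ → ℝ) (m : ℝ) (u : κ → ℝ) : ℝ :=
  Real.exp (m + ∑ k, a k * u k - ∑ k, a k ^ 2 / 2)

theorem wexp_mul (a b : κ → ℝ) (m m' : ℝ) (u : κ → ℝ) :
    wexp a m u * wexp b m' u = Real.exp (m + m' - ∑ k, a k ^ 2 / 2 - ∑ k, b k ^ 2 / 2)
      * Real.exp (∑ k, (a k + b k) * u k) := by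
  rw [wexp, wexp, ← Real.exp_add, ← Real.exp_add]
  simp only [add_mul, Finset.sum_add_distrib]
  congr 1; ring

theorem integrable_wexp_mul (a b : κ → ℝ) (m m' : ℝ) :
    Integrable (fun u => wexp a m u * wexp b m' u) (gaussVec κ) := by
  simp only [wexp_mul]
  exact (integrable_exp_linear _).const_mul _

theorem integral_wexp_mul (a b : κ → ℝ) (m m' : ℝ) :
    ∫ u, wexp a m u * wexp b m' u ∂gaussVec κ = Real.exp (m + m' + ∑ k, a k * b k) := by
  simp only [wexp_mul]
  rw [integral_const_mul, integral_exp_linear, ← Real.exp_add]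
  congr 1
  have : ∑ k, (a k + b k) ^ 2 / 2
      = ∑ k, a k ^ 2 / 2 + ∑ k, b k ^ 2 / 2 + ∑ k, a k * b k := by
    simp only [← Finset.sum_add_distrib]
    exact Finset.sum_congr rfl fun k _ => by ring
  rw [this]; ring

theorem exp_sub_exp_le {a b T : ℝ} (ha : a ≤ T) (hb : b ≤ T) :
    |Real.exp a - Real.exp b| ≤ Real.exp T * |a - b| := by
  wlog h : b ≤ a generalizing a b
  · rw [abs_sub_comm, abs_sub_comm a]
    exact this hb ha (le_of_not_ge h)
  rw [abs_of_nonneg (sub_nonneg.2 h), abs_of_nonneg (sub_nonneg.2 (Real.exp_le_exp.2 h))]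
  have h1 := Real.add_one_le_exp (b - a)
  have h2 : Real.exp b = Real.exp a * Real.exp (b - a) := by rw [← Real.exp_add]; ring_nf
  have h3 : Real.exp a - Real.exp b ≤ Real.exp a * (a - b) := by
    rw [h2]; nlinarith [Real.exp_pos a]
  exact h3.trans (mul_le_mul_of_nonneg_right (Real.exp_le_exp.2 ha) (sub_nonneg.2 h))

section Square

variable {ι : Type*} (s : Finset ι) (r : ι → ℝ) (a b : ι → κ → ℝ) (m m' : ι → ℝ)

theorem sq_sum_wexp (u : κ → ℝ) :
    (∑ i ∈ s, r i * (wexp (a i) (m i) u - wexp (b i) (m' i) u)) ^ 2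
      = ∑ i ∈ s, ∑ j ∈ s, r i * r j *
        (wexp (a i) (m i) u * wexp (a j) (m j) u - wexp (a i) (m i) u * wexp (b j) (m' j) u
          - wexp (b i) (m' i) u * wexp (a j) (m j) u
          + wexp (b i) (m' i) u * wexp (b j) (m' j) u) := by
  rw [sq, Finset.sum_mul_sum]
  exact Finset.sum_congr rfl fun i _ => Finset.sum_congr rfl fun j _ => by ring

theorem integrable_wexp_cross (i j : ι) : Integrable (fun u => r i * r j *
    (wexp (a i) (m i) u * wexp (a j) (m j) u - wexp (a i) (m i) u * wexp (b j) (m' j) u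
      - wexp (b i) (m' i) u * wexp (a j) (m j) u
      + wexp (b i) (m' i) u * wexp (b j) (m' j) u)) (gaussVec κ) :=
  ((((integrable_wexp_mul _ _ _ _).sub (integrable_wexp_mul _ _ _ _)).sub
    (integrable_wexp_mul _ _ _ _)).add (integrable_wexp_mul _ _ _ _)).const_mul _

theorem integrable_sq_sum_wexp :
    Integrable (fun u => (∑ i ∈ s, r i * (wexp (a i) (m i) u - wexp (b i) (m' i) u)) ^ 2)
      (gaussVec κ) := by
  simp only [sq_sum_wexp]
  exact integrable_finsetSum _ fun i _ => integrable_finsetSum _ fun j _ =>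
    integrable_wexp_cross r a b m m' i j

theorem integral_sq_sum_wexp_le (hr : ∀ i ∈ s, 0 ≤ r i) {T : ℝ}
    (h1 : ∀ i ∈ s, ∀ j ∈ s, m i + m j + ∑ k, a i k * a j k ≤ T)
    (h2 : ∀ i ∈ s, ∀ j ∈ s, m i + m' j + ∑ k, a i k * b j k ≤ T)
    (h3 : ∀ i ∈ s, ∀ j ∈ s, m' i + m' j + ∑ k, b i k * b j k ≤ T) :
    ∫ u, (∑ i ∈ s, r i * (wexp (a i) (m i) u - wexp (b i) (m' i) u)) ^ 2 ∂gaussVec κ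
      ≤ Real.exp T * ∑ i ∈ s, ∑ j ∈ s, r i * r j *
        (|m i + m j + ∑ k, a i k * a j k - (m' i + m' j + ∑ k, b i k * b j k)|
          + |m i + m' j + ∑ k, a i k * b j k - (m' i + m' j + ∑ k, b i k * b j k)|
          + |m' i + m j + ∑ k, b i k * a j k - (m' i + m' j + ∑ k, b i k * b j k)|) := by
  simp only [sq_sum_wexp]
  rw [integral_finsetSum _ fun i _ => integrable_finsetSum _ fun j _ =>
    integrable_wexp_cross r a b m m' i j, Finset.mul_sum]
  refine Finset.sum_le_sum fun i hi => ?_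
  rw [integral_finsetSum _ fun j _ => integrable_wexp_cross r a b m m' i j, Finset.mul_sum]
  refine Finset.sum_le_sum fun j hj => ?_
  rw [integral_const_mul, mul_left_comm]
  refine mul_le_mul_of_nonneg_left ?_ (mul_nonneg (hr i hi) (hr j hj))
  have hI : ∀ c d : ι → κ → ℝ, ∀ p q : ι → ℝ, Integrable
      (fun u => wexp (c i) (p i) u * wexp (d j) (q j) u) (gaussVec κ) := fun c d p q =>
    integrable_wexp_mul _ _ _ _
  have hI2 : Integrable (fun u => wexp (a i) (m i) u * wexp (a j) (m j) u
      - wexp (a i) (m i) u * wexp (b j) (m' j) u) (gaussVec κ) := (hI _ _ _ _).sub (hI _ _ _ _)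
  have hI3 : Integrable (fun u => wexp (a i) (m i) u * wexp (a j) (m j) u
      - wexp (a i) (m i) u * wexp (b j) (m' j) u - wexp (b i) (m' i) u * wexp (a j) (m j) u)
      (gaussVec κ) := hI2.sub (hI _ _ _ _)
  rw [integral_add hI3 (hI _ _ _ _), integral_sub hI2 (hI _ _ _ _),
    integral_sub (hI _ _ _ _) (hI _ _ _ _)]
  simp only [integral_wexp_mul]
  have h2' : m' i + m j + ∑ k, b i k * a j k ≤ T := by
    have := h2 j hj i hi
    simp only [mul_comm (b i _)]
    linarith
  have e1 := abs_le.1 (exp_sub_exp_le (h1 i hi j hj) (h3 i hi j hj))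
  have e2 := abs_le.1 (exp_sub_exp_le (h2 i hi j hj) (h3 i hi j hj))
  have e3 := abs_le.1 (exp_sub_exp_le h2' (h3 i hi j hj))
  linarith [e1.2, e2.1, e3.1]

end Square

theorem gaussianReal_eq_withDensity_stdGauss (c : ℝ) :
    gaussianReal c 1
      = stdGauss.withDensity fun z => ENNReal.ofReal (Real.exp (c * z - c ^ 2 / 2)) := by
  rw [stdGauss, gaussianReal_of_var_ne_zero _ one_ne_zero,
    gaussianReal_of_var_ne_zero _ one_ne_zero,
    ← withDensity_mul _ (measurable_gaussianPDF 0 1) (by fun_prop)]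
  congr 1
  ext z
  simp only [Pi.mul_apply, gaussianPDF]
  rw [← ENNReal.ofReal_mul (gaussianPDFReal_nonneg _ _ _)]
  congr 1
  simp only [gaussianPDFReal]
  have h : Real.exp (-(z - c) ^ 2 / (2 * (1 : NNReal)))
      = Real.exp (-(z - 0) ^ 2 / (2 * (1 : NNReal))) * Real.exp (c * z - c ^ 2 / 2) := by
    rw [← Real.exp_add]
    congr 1
    push_cast
    ring
  rw [h, mul_assoc (_)⁻¹]

theorem gaussVec_map_add (c : κ → ℝ) :
    (gaussVec κ).map (fun v => v + c)
      = (gaussVec κ).withDensity fun v =>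
          ENNReal.ofReal (Real.exp (∑ k, (c k * v k - c k ^ 2 / 2))) := by
  have h1 : (gaussVec κ).map (fun v => v + c) = Measure.pi fun k => gaussianReal (c k) 1 := by
    have h := Measure.pi_map_pi (μ := fun _ : κ => stdGauss) (f := fun k z => z + c k)
      (fun k => by fun_prop)
    simp only [stdGauss, gaussianReal_map_add_const, zero_add] at h
    exact h
  rw [h1]
  refine Measure.pi_eq fun s hs => ?_
  rw [withDensity_apply _ (MeasurableSet.univ_pi hs), ← lintegral_indicator
    (MeasurableSet.univ_pi hs)]
  set f : κ → ℝ → ENNReal := fun k =>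
    (s k).indicator fun z => ENNReal.ofReal (Real.exp (c k * z - c k ^ 2 / 2)) with hf
  have hfm : ∀ k, Measurable (f k) := fun k => by
    refine Measurable.indicator ?_ (hs k)
    fun_prop
  have e : (Set.univ.pi s).indicator (fun v =>
      ENNReal.ofReal (Real.exp (∑ k, (c k * v k - c k ^ 2 / 2)))) = fun v => ∏ k, f k (v k) := by
    ext v
    by_cases hv : v ∈ Set.univ.pi s
    · rw [Set.indicator_of_mem hv, Real.exp_sum,
        ENNReal.ofReal_prod_of_nonneg fun _ _ => (Real.exp_pos _).le]
      refine Finset.prod_congr rfl fun k _ => ?_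
      rw [hf]
      simp only
      rw [Set.indicator_of_mem (hv k (Set.mem_univ k))]
    · rw [Set.indicator_of_notMem hv]
      simp only [Set.mem_pi, Set.mem_univ, true_imp_iff, not_forall] at hv
      obtain ⟨k, hk⟩ := hv
      exact (Finset.prod_eq_zero (Finset.mem_univ k) (Set.indicator_of_notMem hk _)).symm
  rw [e]
  have hind := iIndepFun_pi (μ := fun _ : κ => stdGauss) (X := f) fun k => (hfm k).aemeasurable
  refine (lintegral_prod_eq_prod_lintegral_of_indepFun Finset.univ
    (fun k (v : κ → ℝ) => f k (v k)) hind (fun k => (hfm k).comp (measurable_pi_apply k))).trans ?_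
  refine Finset.prod_congr rfl fun k _ => ?_
  have := (measurePreserving_eval (fun _ : κ => stdGauss) k).lintegral_comp (hfm k)
  simp only [Function.eval] at this
  rw [this, lintegral_indicator (hs k), gaussianReal_eq_withDensity_stdGauss,
    withDensity_apply _ (hs k)]

/-- The Cameron–Martin formula for a standard Gaussian vector. -/
theorem integral_gaussVec_add (c : κ → ℝ) (F : (κ → ℝ) → ℝ) :
    ∫ v, F (v + c) ∂gaussVec κ
      = ∫ v, Real.exp (∑ k, (c k * v k - c k ^ 2 / 2)) * F v ∂gaussVec κ := by
  have h := (MeasurableEquiv.addRight c).measurableEmbedding.integral_map (μ := gaussVec κ) F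
  simp only [MeasurableEquiv.coe_addRight] at h
  rw [← h, gaussVec_map_add, integral_withDensity_eq_integral_toReal_smul (by fun_prop)
    (by simp)]
  simp only [ENNReal.toReal_ofReal (Real.exp_pos _).le, smul_eq_mul]

end Gaussian

/-! ### The cavity fields at fixed signal and fixed Hamiltonian -/

/-- The extension by zero of a vector along `e`. -/
def pad {α κ : Type*} (e : α → κ) (x : α → ℝ) : κ → ℝ := Function.extend e x 0

theorem pad_apply {α κ : Type*} {e : α → κ} (he : Function.Injective e) (x : α → ℝ) (i : α) :
    pad e x (e i) = x i := by rw [pad, he.extend_apply]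

section Inner

variable {κ : Type*} [Fintype κ] {P0 : Measure ℝ} {S : Finset ℝ} {n : ℕ}
  {g : (Fin n → ℝ) → ℝ} {K lam : ℝ}

theorem sum_pad_mul {α : Type*} [Fintype α] {e : α → κ} (he : Function.Injective e) (x : α → ℝ)
    (u : κ → ℝ) : ∑ k, pad e x k * u k = ∑ i, x i * u (e i) := by
  refine (Fintype.sum_of_injective e he _ _ (fun k hk => ?_) fun i => ?_).symm
  · rw [pad, Function.extend_apply' _ _ _ (by simpa using hk)]; simp
  · rw [pad, he.extend_apply]

theorem ndot_comm (x y : Fin n → ℝ) : ndot n x y = ndot n y x := by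
  simp only [ndot, mul_comm]

theorem abs_ndot_le {x y : Fin n → ℝ} (hK : 0 ≤ K) (hx : ∀ i, |x i| ≤ K) (hy : ∀ i, |y i| ≤ K) :
    |ndot n x y| ≤ K ^ 2 := by
  rcases Nat.eq_zero_or_pos n with rfl | hn
  · simp [ndot]; positivity
  have hn' : (0 : ℝ) < n := by exact_mod_cast hn
  rw [ndot, abs_mul, abs_of_pos (by positivity)]
  have : |∑ i, x i * y i| ≤ n * K ^ 2 := by
    refine (Finset.abs_sum_le_sum_abs _ _).trans ?_
    refine (Finset.sum_le_card_nsmul _ _ (K ^ 2) fun i _ => ?_).trans_eq (by simp)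
    rw [abs_mul, sq]
    exact mul_le_mul (hx i) (hy i) (abs_nonneg _) hK
  calc 1 / (n : ℝ) * |∑ i, x i * y i| ≤ 1 / n * (n * K ^ 2) := by gcongr
    _ = K ^ 2 := by field_simp

theorem sum_smul_pad_mul_smul_pad {e : Fin n → κ} (he : Function.Injective e) (hlam : 0 ≤ lam)
    (s t : ℝ) (x y : Fin n → ℝ) :
    ∑ k, (s * √(lam / n) * pad e x k) * (t * √(lam / n) * pad e y k)
      = lam * s * t * ndot n x y := by
  have h1 : ∀ k, (s * √(lam / n) * pad e x k) * (t * √(lam / n) * pad e y k)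
      = s * t * (√(lam / n) * √(lam / n)) * (pad e x k * pad e y k) := fun k => by ring
  simp only [h1]
  rw [Real.mul_self_sqrt (by positivity), ← Finset.mul_sum, sum_pad_mul he]
  simp only [pad_apply he, ndot]
  ring

/-- The difference of the two cavity fields, as a function of the fresh Gaussian noise `u`,
the fresh signal coordinate `X'` and its revelation variable `l`. -/
def cavDiff (P0 : Measure ℝ) (S : Finset ℝ) {n : ℕ} (lam : ℝ) (g : (Fin n → ℝ) → ℝ)
    (L : Fin n → Bool) (l : Bool) (X : Fin n → ℝ) (X' : ℝ) (u : Fin n → ℝ) : ℝ :=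
  gavg P0 S g L X (fun x => ∑ σ ∈ S, (P0 {σ}).toReal *
      Real.exp ((if l then X' else σ) * (√(lam / n) * ∑ i, x i * u i + lam * ndot n x X * X')
        + (if l then X' else σ) ^ 2 * (-(lam / 2) * ndot n x x)))
    - ∑ σ ∈ S, (P0 {σ}).toReal *
      Real.exp ((if l then X' else σ) * √(lam / n) *
          (∑ i, gavg P0 S g L X (fun x => x i) * u i)
        + lam * goverlap P0 S g L X * X' * (if l then X' else σ)
        - lam * goverlap P0 S g L X / 2 * (if l then X' else σ) ^ 2)

theorem goverlap_eq_ndot (L : Fin n → Bool) (X : Fin n → ℝ) :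
    goverlap P0 S g L X = ndot n (fun i => gavg P0 S g L X (fun x => x i))
      (fun i => gavg P0 S g L X (fun x => x i)) := by
  simp only [goverlap, ndot, sq]

theorem cavDiff_eq_sum (hS : ∑ σ ∈ S, (P0 {σ}).toReal = 1) (hg : ∀ x, 0 < g x) (hlam : 0 ≤ lam)
    {e : Fin n → κ} (he : Function.Injective e) (L : Fin n → Bool) (l : Bool) (X : Fin n → ℝ)
    (X' : ℝ) (u : κ → ℝ) :
    cavDiff P0 S lam g L l X X' (fun i => u (e i))
      = ∑ z ∈ confs S n ×ˢ S, gprob P0 S g L X z.1 * (P0 {z.2}).toReal *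
        (wexp (fun k => (if l then X' else z.2) * √(lam / n) * pad e (mix L X z.1) k)
            ((if l then X' else z.2) * lam * ndot n (mix L X z.1) X * X') u
          - wexp (fun k => (if l then X' else z.2) * √(lam / n) *
              pad e (fun i => gavg P0 S g L X (fun x => x i)) k)
            ((if l then X' else z.2) * lam * goverlap P0 S g L X * X') u) := by
  have hlin : ∀ (s : ℝ) (x : Fin n → ℝ), ∑ k, s * √(lam / n) * pad e x k * u k
      = s * √(lam / n) * ∑ i, x i * u (e i) := fun s x => by
    rw [← sum_pad_mul he, Finset.mul_sum]
    exact Finset.sum_congr rfl fun k _ => by ring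
  have hsq : ∀ (s : ℝ) (x : Fin n → ℝ), ∑ k, (s * √(lam / n) * pad e x k) ^ 2 / 2
      = lam * s * s * ndot n x x / 2 := fun s x => by
    rw [← sum_smul_pad_mul_smul_pad he hlam, Finset.sum_div]
    exact Finset.sum_congr rfl fun k _ => by ring
  rw [cavDiff, Finset.sum_product, gavg_eq_sum]
  simp only [mul_sub, Finset.sum_sub_distrib]
  congr 1
  · refine Finset.sum_congr rfl fun x _ => ?_
    rw [Finset.mul_sum]
    refine Finset.sum_congr rfl fun σ _ => ?_
    rw [wexp, hlin, hsq, mul_assoc (gprob P0 S g L X x)]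
    congr 3
    ring
  · simp only [mul_assoc (gprob P0 S g L X _), ← Finset.mul_sum]
    rw [← Finset.sum_mul, sum_gprob hS hg, one_mul]
    refine Finset.sum_congr rfl fun σ _ => ?_
    rw [wexp, hlin, hsq, ← goverlap_eq_ndot]
    congr 2
    ring

theorem integrable_cavDiff_sq (hS : ∑ σ ∈ S, (P0 {σ}).toReal = 1) (hg : ∀ x, 0 < g x)
    (hlam : 0 ≤ lam) {e : Fin n → κ} (he : Function.Injective e) (L : Fin n → Bool) (l : Bool)
    (X : Fin n → ℝ) (X' : ℝ) :
    Integrable (fun u => cavDiff P0 S lam g L l X X' (fun i => u (e i)) ^ 2) (gaussVec κ) := by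
  simp only [cavDiff_eq_sum hS hg hlam he]
  exact integrable_sq_sum_wexp _ _ _ _ _ _

theorem sum_gprob_mul_eq_gavg (hS : ∑ σ ∈ S, (P0 {σ}).toReal = 1) (L : Fin n → Bool)
    (X : Fin n → ℝ) (G : (Fin n → ℝ) → (Fin n → ℝ) → ℝ) :
    ∑ z ∈ confs S n ×ˢ S, ∑ w ∈ confs S n ×ˢ S,
        (gprob P0 S g L X z.1 * (P0 {z.2}).toReal) * (gprob P0 S g L X w.1 * (P0 {w.2}).toReal) *
          G (mix L X z.1) (mix L X w.1)
      = gavg P0 S g L X (fun x => gavg P0 S g L X (fun y => G x y)) := by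
  have h1 : ∀ c : (Fin n → ℝ) → ℝ,
      ∑ z ∈ confs S n ×ˢ S, gprob P0 S g L X z.1 * (P0 {z.2}).toReal * c (mix L X z.1)
        = gavg P0 S g L X c := fun c => by
    rw [Finset.sum_product, gavg_eq_sum]
    refine Finset.sum_congr rfl fun x _ => ?_
    simp only
    rw [← Finset.sum_mul, ← Finset.mul_sum, hS, mul_one]
  rw [← h1]
  refine Finset.sum_congr rfl fun z _ => ?_
  rw [← h1, Finset.mul_sum]
  exact Finset.sum_congr rfl fun w _ => by ring

theorem integral_cavDiff_sq_le (hS : ∑ σ ∈ S, (P0 {σ}).toReal = 1) (hg : ∀ x, 0 < g x)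
    (hSK : ∀ σ ∈ S, |σ| ≤ K) (hK : 0 ≤ K) (hlam : 0 ≤ lam) {e : Fin n → κ}
    (he : Function.Injective e) (L : Fin n → Bool) (l : Bool) {X : Fin n → ℝ} (hX : X ∈ confs S n)
    {X' : ℝ} (hX' : X' ∈ S) :
    ∫ u, cavDiff P0 S lam g L l X X' (fun i => u (e i)) ^ 2 ∂gaussVec κ
      ≤ Real.exp (3 * lam * K ^ 4) * (lam * K ^ 2) * gdev P0 S g L X := by
  set b : Fin n → ℝ := fun i => gavg P0 S g L X (fun x => x i) with hb
  set q := goverlap P0 S g L X with hq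
  have hqb : q = ndot n b b := goverlap_eq_ndot L X
  have hbK : ∀ i, |b i| ≤ K := abs_mean_le hS hg hSK L hX
  have hXK : ∀ i, |X i| ≤ K := abs_apply_le_of_mem_confs hSK hX
  have hmK : ∀ x ∈ confs S n, ∀ i, |mix L X x i| ≤ K := fun x hx =>
    abs_apply_le_of_mem_confs hSK (mix_mem_confs L hX hx)
  have hsK : ∀ σ ∈ S, |if l then X' else σ| ≤ K := fun σ hσ => by
    split_ifs
    exacts [hSK _ hX', hSK _ hσ]
  have hprod : ∀ {s t d : ℝ}, |s| ≤ K → |t| ≤ K → |d| ≤ K ^ 2 → lam * s * t * d ≤ lam * K ^ 4 := by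
    intro s t d hs ht hd
    have h1 : |s * t * d| ≤ K * K * K ^ 2 := by
      rw [abs_mul, abs_mul]; gcongr
    have h2 := (le_abs_self _).trans h1
    nlinarith [mul_le_mul_of_nonneg_left h2 hlam]
  have hdiff : ∀ {s t d : ℝ}, |s| ≤ K → |t| ≤ K → |lam * s * t * d| ≤ lam * K ^ 2 * |d| := by
    intro s t d hs ht
    rw [abs_mul, abs_mul, abs_mul, abs_of_nonneg hlam, mul_assoc lam, sq]
    gcongr
  simp only [cavDiff_eq_sum hS hg hlam he]
  refine (integral_sq_sum_wexp_le _ _ _ _ _ _ (T := 3 * lam * K ^ 4) (fun z _ =>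
    mul_nonneg (gprob_nonneg hS hg L X _) ENNReal.toReal_nonneg) ?_ ?_ ?_).trans ?_
  all_goals simp only [sum_smul_pad_mul_smul_pad he hlam, ← hb, ← hq]
  · intro z hz w hw
    rw [Finset.mem_product] at hz hw
    have h1 := hprod (hsK _ hz.2) (hSK _ hX') (abs_ndot_le hK (hmK _ hz.1) hXK)
    have h2 := hprod (hsK _ hw.2) (hSK _ hX') (abs_ndot_le hK (hmK _ hw.1) hXK)
    have h3 := hprod (hsK _ hz.2) (hsK _ hw.2) (abs_ndot_le hK (hmK _ hz.1) (hmK _ hw.1))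
    linarith
  · intro z hz w hw
    rw [Finset.mem_product] at hz hw
    have h1 := hprod (hsK _ hz.2) (hSK _ hX') (abs_ndot_le hK (hmK _ hz.1) hXK)
    have h2 := hprod (hsK _ hw.2) (hSK _ hX') (abs_ndot_le hK hbK hbK)
    have h3 := hprod (hsK _ hz.2) (hsK _ hw.2) (abs_ndot_le hK (hmK _ hz.1) hbK)
    rw [← hqb] at h2
    linarith
  · intro z hz w hw
    rw [Finset.mem_product] at hz hw
    have h1 := hprod (hsK _ hz.2) (hSK _ hX') (abs_ndot_le hK hbK hbK)
    have h2 := hprod (hsK _ hw.2) (hSK _ hX') (abs_ndot_le hK hbK hbK)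
    have h3 := hprod (hsK _ hz.2) (hsK _ hw.2) (abs_ndot_le hK hbK hbK)
    rw [← hqb] at h1 h2
    linarith
  · rw [mul_assoc (Real.exp _)]
    refine mul_le_mul_of_nonneg_left ?_ (Real.exp_pos _).le
    have hG : lam * K ^ 2 * gdev P0 S g L X
        = gavg P0 S g L X (fun y => gavg P0 S g L X (fun x =>
          lam * K ^ 2 * (|ndot n x y - q| + 2 * |ndot n x X - q| + 2 * |ndot n y X - q|
            + |ndot n x b - q| + |ndot n y b - q|))) := by
      simp only [gavg_const_mul, gavg_add, gavg_const hS hg]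
      rw [gdev]
      ring
    rw [hG, ← sum_gprob_mul_eq_gavg hS]
    refine Finset.sum_le_sum fun z hz => Finset.sum_le_sum fun w hw => ?_
    refine mul_le_mul_of_nonneg_left ?_ (mul_nonneg
      (mul_nonneg (gprob_nonneg hS hg L X _) ENNReal.toReal_nonneg)
      (mul_nonneg (gprob_nonneg hS hg L X _) ENNReal.toReal_nonneg))
    rw [Finset.mem_product] at hz hw
    rw [← hqb, ndot_comm b (mix L X w.1), ndot_comm (mix L X z.1) (mix L X w.1)]
    have hs := hsK _ hz.2
    have ht := hsK _ hw.2
    have hX'K := hSK _ hX'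
    set s := if l then X' else z.2
    set t := if l then X' else w.2
    set x := mix L X w.1
    set y := mix L X z.1
    have e1 := abs_le.1 (hdiff (d := ndot n y X - q) hs hX'K)
    have e2 := abs_le.1 (hdiff (d := ndot n x X - q) ht hX'K)
    have e3 := abs_le.1 (hdiff (d := ndot n x y - q) hs ht)
    have e4 := abs_le.1 (hdiff (d := ndot n x b - q) hs ht)
    have e5 := abs_le.1 (hdiff (d := ndot n y b - q) hs ht)
    have f1 : |s * lam * ndot n y X * X' + t * lam * ndot n x X * X' + lam * s * t * ndot n x y
        - (s * lam * q * X' + t * lam * q * X' + lam * s * t * q)|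
        ≤ lam * K ^ 2 * |ndot n y X - q| + lam * K ^ 2 * |ndot n x X - q|
          + lam * K ^ 2 * |ndot n x y - q| :=
      abs_le.2 ⟨by linarith [e1.1, e2.1, e3.1], by linarith [e1.2, e2.2, e3.2]⟩
    have f2 : |s * lam * ndot n y X * X' + t * lam * q * X' + lam * s * t * ndot n y b
        - (s * lam * q * X' + t * lam * q * X' + lam * s * t * q)|
        ≤ lam * K ^ 2 * |ndot n y X - q| + lam * K ^ 2 * |ndot n y b - q| :=
      abs_le.2 ⟨by linarith [e1.1, e5.1], by linarith [e1.2, e5.2]⟩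
    have f3 : |s * lam * q * X' + t * lam * ndot n x X * X' + lam * s * t * ndot n x b
        - (s * lam * q * X' + t * lam * q * X' + lam * s * t * q)|
        ≤ lam * K ^ 2 * |ndot n x X - q| + lam * K ^ 2 * |ndot n x b - q| :=
      abs_le.2 ⟨by linarith [e2.1, e4.1], by linarith [e2.2, e4.2]⟩
    linarith

end Inner

/-! ### Revealing coordinates with increasing probability -/

section Reveal

/-- The Bernoulli probabilities. -/
def bprob (q : ℝ) (b : Bool) : ℝ := if b then q else 1 - q

/-- The probability of a revelation pattern. -/
def bweight {n : ℕ} (q : ℝ) (L : Fin n → Bool) : ℝ := ∏ i, bprob q (L i)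

variable {n : ℕ}

theorem bprob_nonneg {q : ℝ} (hq : q ∈ Set.Icc (0 : ℝ) 1) (b : Bool) : 0 ≤ bprob q b := by
  cases b <;> simp [bprob, hq.1, hq.2]

theorem bweight_nonneg {q : ℝ} (hq : q ∈ Set.Icc (0 : ℝ) 1) (L : Fin n → Bool) :
    0 ≤ bweight q L := Finset.prod_nonneg fun _ _ => bprob_nonneg hq _

theorem sum_bprob (q : ℝ) : ∑ b, bprob q b = 1 := by simp [bprob]

theorem sum_bweight (q : ℝ) : ∑ L : Fin n → Bool, bweight q L = 1 := by
  have h := Finset.prod_univ_sum (fun _ : Fin n => (Finset.univ : Finset Bool))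
    (fun _ b => bprob q b)
  simp only [sum_bprob, Finset.prod_const_one, Fintype.piFinset_univ] at h
  exact h.symm

theorem hasDerivAt_bprob (q : ℝ) (b : Bool) :
    HasDerivAt (fun q => bprob q b) (if b then 1 else -1) q := by
  cases b
  · simpa [bprob] using (hasDerivAt_id q).const_sub 1
  · simpa [bprob] using hasDerivAt_id' q

theorem continuous_bprob (b : Bool) : Continuous fun q => bprob q b :=
  continuous_iff_continuousAt.2 fun q => (hasDerivAt_bprob q b).continuousAt

theorem continuous_bweight (L : Fin n → Bool) : Continuous fun q => bweight q L :=
  continuous_finsetProd _ fun i _ => continuous_bprob (L i)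

theorem sum_eq_sum_filter_false (j : Fin n) (F : (Fin n → Bool) → ℝ) :
    ∑ L, F L = ∑ L with L j = false, (F (Function.update L j true) + F L) := by
  rw [Finset.sum_add_distrib, ← Finset.sum_filter_not_add_sum_filter _ fun L => L j = false]
  congr 1
  refine Finset.sum_nbij' (fun L => Function.update L j false)
    (fun L => Function.update L j true) ?_ ?_ ?_ ?_ ?_
  · simp
  · simp
  · intro L hL
    have : L j = true := by simpa using hL
    rw [Function.update_idem, ← this, Function.update_eq_self]
  · intro L hL
    have : L j = false := by simpa using hL
    rw [Function.update_idem, ← this, Function.update_eq_self]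
  · intro L hL
    have : L j = true := by simpa using hL
    rw [Function.update_idem, ← this, Function.update_eq_self]

theorem prod_erase_update (j : Fin n) (q : ℝ) (L : Fin n → Bool) (b : Bool) :
    ∏ i ∈ Finset.univ.erase j, bprob q (Function.update L j b i)
      = ∏ i ∈ Finset.univ.erase j, bprob q (L i) :=
  Finset.prod_congr rfl fun i hi => by rw [Function.update_of_ne (Finset.ne_of_mem_erase hi)]

theorem hasDerivAt_sum_bweight (φ : (Fin n → Bool) → ℝ) (q : ℝ) :
    HasDerivAt (fun q => ∑ L, bweight q L * φ L)
      (∑ L, (∑ j, (∏ i ∈ Finset.univ.erase j, bprob q (L i)) * (if L j then 1 else -1)) * φ L)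
      q := by
  refine HasDerivAt.fun_sum fun L _ => HasDerivAt.mul_const ?_ _
  simpa [bweight] using HasDerivAt.fun_finsetProd (u := Finset.univ)
    (f := fun i q => bprob q (L i)) (x := q) fun i _ => hasDerivAt_bprob q (L i)

/-- If revealing coordinate `j` increases `φ` by at least a multiple of `ψ j`, then the integral
over the revelation probability of the mean of `∑ j, ψ j` is bounded by the increase of the
mean of `φ`. -/
theorem integral_sum_bweight_le (φ : (Fin n → Bool) → ℝ) (ψ : Fin n → (Fin n → Bool) → ℝ) {C : ℝ}
    (h0 : ∀ j L, 0 ≤ ψ j L) (h1 : ∀ j L, L j = true → ψ j L = 0)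
    (h2 : ∀ j L, ψ j L ≤ C * (φ (Function.update L j true) - φ L)) {ε₀ : ℝ}
    (hε : ε₀ ∈ Set.Icc (0 : ℝ) 1) :
    ∫ q in (0 : ℝ)..ε₀, ∑ L, bweight q L * ∑ j, ψ j L
      ≤ C * (∑ L, bweight ε₀ L * φ L - ∑ L, bweight 0 L * φ L) := by
  have hc1 : Continuous fun q => ∑ L : Fin n → Bool, bweight q L * ∑ j, ψ j L :=
    continuous_finsetSum _ fun L _ => (continuous_bweight L).mul continuous_const
  have hc2 : Continuous fun q => ∑ L : Fin n → Bool, (∑ j,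
      (∏ i ∈ Finset.univ.erase j, bprob q (L i)) * (if L j then (1 : ℝ) else -1)) * φ L :=
    continuous_finsetSum _ fun L _ => (continuous_finsetSum _ fun j _ =>
      (continuous_finsetProd _ fun i _ => continuous_bprob (L i)).mul
        continuous_const).mul continuous_const
  have hF := intervalIntegral.integral_eq_sub_of_hasDerivAt
    (fun q _ => hasDerivAt_sum_bweight φ q) (hc2.intervalIntegrable 0 ε₀)
  rw [← hF, ← intervalIntegral.integral_const_mul]
  refine intervalIntegral.integral_mono_on hε.1 (hc1.intervalIntegrable _ _)
    ((hc2.const_mul C).intervalIntegrable _ _) fun q hq => ?_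
  have hq1 : q ∈ Set.Icc (0 : ℝ) 1 := ⟨hq.1, hq.2.trans hε.2⟩
  have e1 : ∑ L : Fin n → Bool, bweight q L * ∑ j, ψ j L
      = ∑ j, ∑ L : Fin n → Bool, bweight q L * ψ j L := by
    simp only [Finset.mul_sum]
    exact Finset.sum_comm
  have e2 : C * ∑ L : Fin n → Bool, (∑ j,
      (∏ i ∈ Finset.univ.erase j, bprob q (L i)) * (if L j then (1 : ℝ) else -1)) * φ L
      = ∑ j, ∑ L : Fin n → Bool, C *
        ((∏ i ∈ Finset.univ.erase j, bprob q (L i)) * (if L j then (1 : ℝ) else -1) * φ L) := by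
    simp only [Finset.sum_mul, Finset.mul_sum]
    exact Finset.sum_comm
  rw [e1, e2]
  refine Finset.sum_le_sum fun j _ => ?_
  rw [sum_eq_sum_filter_false j, sum_eq_sum_filter_false j]
  refine Finset.sum_le_sum fun L hL => ?_
  have hLj : L j = false := by simpa using hL
  have hp : 0 ≤ ∏ i ∈ Finset.univ.erase j, bprob q (L i) :=
    Finset.prod_nonneg fun _ _ => bprob_nonneg hq1 _
  rw [h1 j (Function.update L j true) (by simp), prod_erase_update, bweight,
    bweight, ← Finset.mul_prod_erase _ (fun i => bprob q (L i)) (Finset.mem_univ j), hLj]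
  set p := ∏ i ∈ Finset.univ.erase j, bprob q (L i)
  have h3 : bprob q false ≤ 1 := by simp [bprob, hq1.1]
  have h4 : bprob q false * p * ψ j L ≤ p * (C * (φ (Function.update L j true) - φ L)) := by
    calc bprob q false * p * ψ j L = bprob q false * (p * ψ j L) := by ring
      _ ≤ 1 * (p * ψ j L) := mul_le_mul_of_nonneg_right h3 (mul_nonneg hp (h0 j L))
      _ = p * ψ j L := one_mul _
      _ ≤ _ := mul_le_mul_of_nonneg_left (h2 j L) hp
  simp only [Function.update_self, if_true, Bool.false_eq_true, if_false]
  linarith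

end Reveal

/-! ### Averaging over the Gaussian channel -/

section Channel

variable {ι : Type*} [Fintype ι] {P0 : Measure ℝ} {S : Finset ℝ} {n : ℕ} {K : ℝ}

/-- The likelihood ratio of the Gaussian channel `x ↦ θ x + noise` at the observation `v`. -/
def chan (θ : (Fin n → ℝ) → ι → ℝ) (v : ι → ℝ) (x : Fin n → ℝ) : ℝ :=
  Real.exp (∑ k, (θ x k * v k - θ x k ^ 2 / 2))

variable (θ : (Fin n → ℝ) → ι → ℝ)

theorem chan_pos (v : ι → ℝ) (x : Fin n → ℝ) : 0 < chan θ v x := Real.exp_pos _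

theorem chan_eq (v : ι → ℝ) (x : Fin n → ℝ) :
    chan θ v x = Real.exp (-∑ k, θ x k ^ 2 / 2) * Real.exp (∑ k, θ x k * v k) := by
  rw [chan, ← Real.exp_add, Finset.sum_sub_distrib]
  ring_nf

theorem continuous_chan (x : Fin n → ℝ) : Continuous fun v => chan θ v x := by
  unfold chan
  fun_prop

theorem integrable_chan (x : Fin n → ℝ) : Integrable (fun v => chan θ v x) (gaussVec ι) := by
  simp only [chan_eq]
  exact (integrable_exp_linear _).const_mul _

theorem continuous_gavg_chan (hS : ∑ σ ∈ S, (P0 {σ}).toReal = 1) (L : Fin n → Bool)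
    (X : Fin n → ℝ) {f : (ι → ℝ) → (Fin n → ℝ) → ℝ} (hf : ∀ x, Continuous fun v => f v x) :
    Continuous fun v => gavg P0 S (chan θ v) L X (f v) := by
  simp only [gavg]
  refine Continuous.div ?_ ?_ fun v => (gnorm_pos hS (chan_pos θ v) L X).ne'
  · exact continuous_finsetSum _ fun x _ =>
      (continuous_const.mul (hf _)).mul (continuous_chan θ _)
  · exact continuous_finsetSum _ fun x _ => continuous_const.mul (continuous_chan θ _)

theorem continuous_gavg_chan_const (hS : ∑ σ ∈ S, (P0 {σ}).toReal = 1) (L : Fin n → Bool)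
    (X : Fin n → ℝ) (f : (Fin n → ℝ) → ℝ) : Continuous fun v => gavg P0 S (chan θ v) L X f :=
  continuous_gavg_chan θ hS L X (f := fun _ => f) fun _ => continuous_const

theorem continuous_sum_mean_sq_chan (hS : ∑ σ ∈ S, (P0 {σ}).toReal = 1) (L : Fin n → Bool)
    (X : Fin n → ℝ) :
    Continuous fun v => ∑ i, gavg P0 S (chan θ v) L X (fun x => x i) ^ 2 :=
  continuous_finsetSum _ fun i _ => (continuous_gavg_chan_const θ hS L X fun x => x i).pow 2

theorem continuous_goverlap_chan (hS : ∑ σ ∈ S, (P0 {σ}).toReal = 1) (L : Fin n → Bool)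
    (X : Fin n → ℝ) : Continuous fun v => goverlap P0 S (chan θ v) L X :=
  (continuous_sum_mean_sq_chan θ hS L X).const_mul _

theorem continuous_gcov_chan (hS : ∑ σ ∈ S, (P0 {σ}).toReal = 1) (L : Fin n → Bool)
    (X : Fin n → ℝ) (i j : Fin n) : Continuous fun v => gcov P0 S (chan θ v) L X i j :=
  (continuous_gavg_chan_const θ hS L X fun x => x i * x j).sub
    ((continuous_gavg_chan_const θ hS L X fun x => x i).mul
      (continuous_gavg_chan_const θ hS L X fun x => x j))

theorem continuous_gdev_chan (hS : ∑ σ ∈ S, (P0 {σ}).toReal = 1) (L : Fin n → Bool)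
    (X : Fin n → ℝ) : Continuous fun v => gdev P0 S (chan θ v) L X := by
  have hq := continuous_goverlap_chan θ hS L X
  refine ((continuous_gavg_chan θ hS L X fun y => continuous_gavg_chan θ hS L X fun x =>
    (continuous_const.sub hq).abs).add ((continuous_gavg_chan θ hS L X fun x =>
    (continuous_const.sub hq).abs).const_mul 4)).add ((continuous_gavg_chan θ hS L X fun x =>
    (Continuous.sub ?_ hq).abs).const_mul 2)
  exact continuous_const.mul (continuous_finsetSum _ fun i _ => continuous_const.mul
    (continuous_gavg_chan_const θ hS L X fun x => x i))

theorem abs_gdev_le {g : (Fin n → ℝ) → ℝ} (hS : ∑ σ ∈ S, (P0 {σ}).toReal = 1)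
    (hg : ∀ x, 0 < g x) (hSK : ∀ σ ∈ S, |σ| ≤ K) (hK : 0 ≤ K) (L : Fin n → Bool)
    {X : Fin n → ℝ} (hX : X ∈ confs S n) : |gdev P0 S g L X| ≤ 14 * K ^ 2 := by
  have hb : ∀ i, |gavg P0 S g L X (fun x => x i)| ≤ K := abs_mean_le hS hg hSK L hX
  have hq : |goverlap P0 S g L X| ≤ K ^ 2 := by
    rw [goverlap_eq_ndot]; exact abs_ndot_le hK hb hb
  have h : ∀ x ∈ confs S n, ∀ a : Fin n → ℝ, (∀ i, |a i| ≤ K) →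
      |(|ndot n x a - goverlap P0 S g L X|)| ≤ 2 * K ^ 2 := fun x hx a ha => by
    rw [abs_abs]
    have := abs_ndot_le hK (abs_apply_le_of_mem_confs hSK hx) ha
    exact (abs_sub _ _).trans (by linarith)
  have h1 := abs_gavg_le hS hg L hX fun y hy => abs_gavg_le hS hg L hX fun x hx =>
    h x hx y (abs_apply_le_of_mem_confs hSK hy)
  have h2 := abs_gavg_le hS hg L hX fun x hx => h x hx X (abs_apply_le_of_mem_confs hSK hX)
  have h3 := abs_gavg_le hS hg L hX fun x hx => h x hx _ hb
  rw [gdev]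
  rw [abs_le] at *
  constructor <;> linarith [h1.1, h1.2, h2.1, h2.2, h3.1, h3.2]

theorem abs_gcov_le {g : (Fin n → ℝ) → ℝ} (hS : ∑ σ ∈ S, (P0 {σ}).toReal = 1)
    (hg : ∀ x, 0 < g x) (hSK : ∀ σ ∈ S, |σ| ≤ K) (hK : 0 ≤ K) (L : Fin n → Bool)
    {X : Fin n → ℝ} (hX : X ∈ confs S n) (i j : Fin n) : |gcov P0 S g L X i j| ≤ 2 * K ^ 2 := by
  have h1 : |gavg P0 S g L X (fun x => x i * x j)| ≤ K * K :=
    abs_gavg_le hS hg L hX fun x hx => by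
      rw [abs_mul]
      exact mul_le_mul (abs_apply_le_of_mem_confs hSK hx i) (abs_apply_le_of_mem_confs hSK hx j)
        (abs_nonneg _) hK
  have h2 : |gavg P0 S g L X (fun x => x i) * gavg P0 S g L X (fun x => x j)| ≤ K * K := by
    rw [abs_mul]
    exact mul_le_mul (abs_mean_le hS hg hSK L hX i) (abs_mean_le hS hg hSK L hX j)
      (abs_nonneg _) hK
  exact (abs_sub _ _).trans (by linarith)

variable {F : (ι → ℝ) → (Fin n → ℝ) → ℝ} {C : ℝ}

theorem integrable_mul_chan (hF : ∀ X, Continuous fun v => F v X) {X : Fin n → ℝ}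
    (hC : ∀ v, |F v X| ≤ C) :
    Integrable (fun v => F v X * chan θ v X) (gaussVec ι) := by
  refine ((integrable_chan θ X).const_mul C).mono'
    ((hF X).mul (continuous_chan θ X)).aestronglyMeasurable (ae_of_all _ fun v => ?_)
  rw [norm_mul, Real.norm_eq_abs, Real.norm_of_nonneg (chan_pos θ v X).le]
  exact mul_le_mul_of_nonneg_right (hC v) (chan_pos θ v X).le

theorem integrable_gmean_chan (hF : ∀ X, Continuous fun v => F v X)
    (hC : ∀ v, ∀ X ∈ confs S n, |F v X| ≤ C) :
    Integrable (fun v => gmean P0 S (chan θ v) (F v)) (gaussVec ι) := by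
  simp only [gmean, mul_assoc]
  exact integrable_finsetSum _ fun X hX =>
    (integrable_mul_chan θ hF fun v => hC v X hX).const_mul _

/-- Averaging over the signal and the noise is averaging over the observation and the posterior. -/
theorem sum_weight_mul_integral_eq (hF : ∀ X, Continuous fun v => F v X)
    (hC : ∀ v, ∀ X ∈ confs S n, |F v X| ≤ C) :
    ∑ X ∈ confs S n, weight P0 n X * ∫ v, F (v + θ X) X ∂gaussVec ι
      = ∫ v, gmean P0 S (chan θ v) (F v) ∂gaussVec ι := by
  simp only [gmean, mul_assoc]
  rw [integral_finsetSum _ fun X hX =>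
    (integrable_mul_chan θ hF fun v => hC v X hX).const_mul _]
  refine Finset.sum_congr rfl fun X _ => ?_
  rw [integral_const_mul, integral_gaussVec_add (θ X) fun v => F v X]
  simp only [chan, mul_comm (F _ X)]

theorem integral_gmean_chan_const (hS : ∑ σ ∈ S, (P0 {σ}).toReal = 1) (c : ℝ) :
    ∫ v, gmean P0 S (chan θ v) (fun _ => c) ∂gaussVec ι = c := by
  rw [← sum_weight_mul_integral_eq θ (F := fun _ _ => c) (C := |c|)
    (fun _ => continuous_const) fun _ _ _ => le_rfl]
  simp [← Finset.sum_mul, sum_weight hS]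

theorem integral_gmean_chan_mono {F' : (ι → ℝ) → (Fin n → ℝ) → ℝ} {C' : ℝ}
    (hF : ∀ X, Continuous fun v => F v X) (hC : ∀ v, ∀ X ∈ confs S n, |F v X| ≤ C)
    (hF' : ∀ X, Continuous fun v => F' v X) (hC' : ∀ v, ∀ X ∈ confs S n, |F' v X| ≤ C')
    (h : ∀ v, ∀ X ∈ confs S n, F v X ≤ F' v X) :
    ∫ v, gmean P0 S (chan θ v) (F v) ∂gaussVec ι
      ≤ ∫ v, gmean P0 S (chan θ v) (F' v) ∂gaussVec ι :=
  integral_mono (integrable_gmean_chan θ hF hC) (integrable_gmean_chan θ hF' hC')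
    fun v => gmean_mono (chan_pos θ v) (h v)

/-- The mean overlap deviation, given the revelation pattern. -/
def chanDev (P0 : Measure ℝ) (S : Finset ℝ) (θ : (Fin n → ℝ) → ι → ℝ) (L : Fin n → Bool) : ℝ :=
  ∫ v, gmean P0 S (chan θ v) (gdev P0 S (chan θ v) L) ∂gaussVec ι

/-- The mean squared posterior covariances with the coordinate `j`. -/
def chanCov (P0 : Measure ℝ) (S : Finset ℝ) (θ : (Fin n → ℝ) → ι → ℝ) (j : Fin n)
    (L : Fin n → Bool) : ℝ :=
  ∫ v, gmean P0 S (chan θ v) (fun X => ∑ i, gcov P0 S (chan θ v) L X i j ^ 2) ∂gaussVec ι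

/-- The mean squared norm of the posterior mean. -/
def chanOverlap (P0 : Measure ℝ) (S : Finset ℝ) (θ : (Fin n → ℝ) → ι → ℝ) (L : Fin n → Bool) : ℝ :=
  ∫ v, gmean P0 S (chan θ v) (fun X => ∑ i, gavg P0 S (chan θ v) L X (fun x => x i) ^ 2)
    ∂gaussVec ι

theorem sum_mean_sq_le {g : (Fin n → ℝ) → ℝ} (hS : ∑ σ ∈ S, (P0 {σ}).toReal = 1)
    (hg : ∀ x, 0 < g x) (hSK : ∀ σ ∈ S, |σ| ≤ K) (L : Fin n → Bool)
    {X : Fin n → ℝ} (hX : X ∈ confs S n) :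
    ∑ i, gavg P0 S g L X (fun x => x i) ^ 2 ≤ n * K ^ 2 := by
  refine (Finset.sum_le_card_nsmul _ _ (K ^ 2) fun i _ => ?_).trans_eq (by simp)
  exact sq_le_sq' (abs_le.1 (abs_mean_le hS hg hSK L hX i)).1
    (abs_le.1 (abs_mean_le hS hg hSK L hX i)).2

theorem abs_sum_mean_sq_le {g : (Fin n → ℝ) → ℝ} (hS : ∑ σ ∈ S, (P0 {σ}).toReal = 1)
    (hg : ∀ x, 0 < g x) (hSK : ∀ σ ∈ S, |σ| ≤ K) (L : Fin n → Bool)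
    {X : Fin n → ℝ} (hX : X ∈ confs S n) :
    |∑ i, gavg P0 S g L X (fun x => x i) ^ 2| ≤ n * K ^ 2 := by
  rw [abs_of_nonneg (Finset.sum_nonneg fun _ _ => sq_nonneg _)]
  exact sum_mean_sq_le hS hg hSK L hX

theorem continuous_gcov_sq_chan (hS : ∑ σ ∈ S, (P0 {σ}).toReal = 1) (L : Fin n → Bool)
    (X : Fin n → ℝ) (j : Fin n) :
    Continuous fun v => ∑ i, gcov P0 S (chan θ v) L X i j ^ 2 :=
  continuous_finsetSum _ fun i _ => (continuous_gcov_chan θ hS L X i j).pow 2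

theorem abs_sum_gcov_sq_le {g : (Fin n → ℝ) → ℝ} (hS : ∑ σ ∈ S, (P0 {σ}).toReal = 1)
    (hg : ∀ x, 0 < g x) (hSK : ∀ σ ∈ S, |σ| ≤ K) (hK : 0 ≤ K) (L : Fin n → Bool)
    {X : Fin n → ℝ} (hX : X ∈ confs S n) (j : Fin n) :
    |∑ i, gcov P0 S g L X i j ^ 2| ≤ n * (2 * K ^ 2) ^ 2 := by
  rw [abs_of_nonneg (Finset.sum_nonneg fun _ _ => sq_nonneg _)]
  refine (Finset.sum_le_card_nsmul _ _ ((2 * K ^ 2) ^ 2) fun i _ => ?_).trans_eq (by simp)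
  exact sq_le_sq' (abs_le.1 (abs_gcov_le hS hg hSK hK L hX i j)).1
    (abs_le.1 (abs_gcov_le hS hg hSK hK L hX i j)).2

theorem integrable_chanCov (hS : ∑ σ ∈ S, (P0 {σ}).toReal = 1) (hSK : ∀ σ ∈ S, |σ| ≤ K)
    (hK : 0 ≤ K) (j : Fin n) (L : Fin n → Bool) :
    Integrable (fun v => gmean P0 S (chan θ v)
      (fun X => ∑ i, gcov P0 S (chan θ v) L X i j ^ 2)) (gaussVec ι) :=
  integrable_gmean_chan θ (fun X => continuous_gcov_sq_chan θ hS L X j)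
    fun v _ hX => abs_sum_gcov_sq_le hS (chan_pos θ v) hSK hK L hX j

theorem integrable_chanOverlap (hS : ∑ σ ∈ S, (P0 {σ}).toReal = 1) (hSK : ∀ σ ∈ S, |σ| ≤ K)
    (L : Fin n → Bool) :
    Integrable (fun v => gmean P0 S (chan θ v)
      (fun X => ∑ i, gavg P0 S (chan θ v) L X (fun x => x i) ^ 2)) (gaussVec ι) :=
  integrable_gmean_chan θ (fun X => continuous_sum_mean_sq_chan θ hS L X)
    fun v _ hX => abs_sum_mean_sq_le hS (chan_pos θ v) hSK L hX

theorem gmean_nonneg {g : (Fin n → ℝ) → ℝ} (hg : ∀ x, 0 < g x) {F : (Fin n → ℝ) → ℝ}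
    (hF : ∀ X, 0 ≤ F X) : 0 ≤ gmean P0 S g F :=
  Finset.sum_nonneg fun X _ => mul_nonneg (mul_nonneg (weight_nonneg P0 X) (hF X)) (hg X).le

theorem chanOverlap_nonneg (L : Fin n → Bool) : 0 ≤ chanOverlap P0 S θ L :=
  integral_nonneg fun v => gmean_nonneg (chan_pos θ v) fun _ =>
    Finset.sum_nonneg fun _ _ => sq_nonneg _

theorem chanCov_nonneg (j : Fin n) (L : Fin n → Bool) : 0 ≤ chanCov P0 S θ j L :=
  integral_nonneg fun v => gmean_nonneg (chan_pos θ v) fun _ =>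
    Finset.sum_nonneg fun _ _ => sq_nonneg _

theorem chanOverlap_le (hS : ∑ σ ∈ S, (P0 {σ}).toReal = 1) (hSK : ∀ σ ∈ S, |σ| ≤ K)
    (L : Fin n → Bool) : chanOverlap P0 S θ L ≤ n * K ^ 2 := by
  rw [← integral_gmean_chan_const (P0 := P0) (S := S) θ hS (n * K ^ 2)]
  exact integral_gmean_chan_mono θ (fun X => continuous_sum_mean_sq_chan θ hS L X)
    (fun v _ hX => abs_sum_mean_sq_le hS (chan_pos θ v) hSK L hX)
    (fun _ => continuous_const) (fun _ _ _ => le_rfl)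
    fun v _ hX => sum_mean_sq_le hS (chan_pos θ v) hSK L hX

theorem chanCov_eq_zero (hS : ∑ σ ∈ S, (P0 {σ}).toReal = 1) (j : Fin n) (L : Fin n → Bool)
    (hj : L j = true) : chanCov P0 S θ j L = 0 := by
  have h : ∀ v X i, gcov P0 S (chan θ v) L X i j = 0 := fun v X i =>
    gcov_eq_zero hj X hS (chan_pos θ v) i
  simp [chanCov, h, gmean]

theorem chanCov_le (hS : ∑ σ ∈ S, (P0 {σ}).toReal = 1) (hSK : ∀ σ ∈ S, |σ| ≤ K)
    (hK : 0 ≤ K) (j : Fin n) (L : Fin n → Bool) :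
    chanCov P0 S θ j L ≤ K ^ 2 * (chanOverlap P0 S θ (Function.update L j true)
      - chanOverlap P0 S θ L) := by
  rw [chanOverlap, chanOverlap, ← integral_sub (integrable_chanOverlap θ hS hSK _)
    (integrable_chanOverlap θ hS hSK _), ← integral_const_mul]
  refine integral_mono (integrable_chanCov θ hS hSK hK j L)
    (((integrable_chanOverlap θ hS hSK _).sub
      (integrable_chanOverlap θ hS hSK _)).const_mul _) fun v => ?_
  simp only [gmean_sum]
  rw [← Finset.sum_sub_distrib, Finset.mul_sum]
  exact Finset.sum_le_sum fun i _ => gmean_gcov_sq_le hS (chan_pos θ v) hSK L i j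

theorem chanDev_le (hS : ∑ σ ∈ S, (P0 {σ}).toReal = 1) (hSK : ∀ σ ∈ S, |σ| ≤ K)
    (hK : 0 ≤ K) (L : Fin n → Bool) (hn : 0 < n) {η : ℝ} (hη : 0 < η) :
    chanDev P0 S θ L ≤ (7 + 14 * K ^ 2) * η
      + 7 / η * (1 + 2 * K ^ 2 / η ^ 2) * ((1 / n : ℝ) ^ 2 * ∑ j, chanCov P0 S θ j L) := by
  have h1 : Integrable (fun v => (7 + 14 * K ^ 2) * η * gmean P0 S (chan θ v) (fun _ => 1))
      (gaussVec ι) :=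
    (integrable_gmean_chan θ (F := fun _ _ => 1) (C := |1|) (fun _ => continuous_const)
      fun _ _ _ => le_rfl).const_mul _
  have h2 : Integrable (fun v => 7 / η * (1 + 2 * K ^ 2 / η ^ 2) * ((1 / n : ℝ) ^ 2 *
      ∑ j, gmean P0 S (chan θ v) (fun X => ∑ i, gcov P0 S (chan θ v) L X i j ^ 2)))
      (gaussVec ι) :=
    ((integrable_finsetSum _ fun j _ => integrable_chanCov θ hS hSK hK j L).const_mul _).const_mul _
  have e : (7 + 14 * K ^ 2) * η
      + 7 / η * (1 + 2 * K ^ 2 / η ^ 2) * ((1 / n : ℝ) ^ 2 * ∑ j, chanCov P0 S θ j L)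
      = ∫ v, ((7 + 14 * K ^ 2) * η * gmean P0 S (chan θ v) (fun _ => 1)
        + 7 / η * (1 + 2 * K ^ 2 / η ^ 2) * ((1 / n : ℝ) ^ 2 *
      ∑ j, gmean P0 S (chan θ v) (fun X => ∑ i, gcov P0 S (chan θ v) L X i j ^ 2)))
        ∂gaussVec ι := by
    rw [integral_add h1 h2, integral_const_mul, integral_const_mul, integral_const_mul,
      integral_finsetSum _ fun j _ => integrable_chanCov θ hS hSK hK j L,
      integral_gmean_chan_const θ hS, mul_one]
    rfl
  rw [e]
  refine integral_mono (integrable_gmean_chan θ (fun X => continuous_gdev_chan θ hS L X)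
    fun v _ hX => abs_gdev_le hS (chan_pos θ v) hSK hK L hX) (h1.add h2) fun v => ?_
  refine (gmean_gdev_le hS (chan_pos θ v) hSK L hn hη).trans_eq ?_
  have : gmean P0 S (chan θ v) (gcovSq P0 S (chan θ v) L) = (1 / n : ℝ) ^ 2 *
      ∑ j, gmean P0 S (chan θ v) (fun X => ∑ i, gcov P0 S (chan θ v) L X i j ^ 2) := by
    rw [← gmean_sum, ← gmean_const_mul]
    congr 1
    ext X
    rw [gcovSq, Finset.sum_comm]
  rw [this]

/-- The overlap concentrates, on average over the revelation probability. -/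
theorem integral_sum_bweight_chanDev_le (hS : ∑ σ ∈ S, (P0 {σ}).toReal = 1)
    (hSK : ∀ σ ∈ S, |σ| ≤ K) (hK : 0 ≤ K) (hn : 0 < n) {η : ℝ} (hη : 0 < η) {ε₀ : ℝ}
    (hε : ε₀ ∈ Set.Icc (0 : ℝ) 1) :
    ∫ q in (0 : ℝ)..ε₀, ∑ L : Fin n → Bool, bweight q L * chanDev P0 S θ L
      ≤ (7 + 14 * K ^ 2) * η + 7 / η * (1 + 2 * K ^ 2 / η ^ 2) * (K ^ 4 / n) := by
  set A := (7 + 14 * K ^ 2) * η with hA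
  set B := 7 / η * (1 + 2 * K ^ 2 / η ^ 2) with hB
  have hA0 : 0 ≤ A := by positivity
  have hB0 : 0 ≤ B := by positivity
  have hn' : (0 : ℝ) < n := by exact_mod_cast hn
  have hcont : ∀ c : (Fin n → Bool) → ℝ, Continuous fun q => ∑ L, bweight q L * c L := fun c =>
    continuous_finsetSum _ fun L _ => (continuous_bweight L).mul continuous_const
  have h1 : ∫ q in (0 : ℝ)..ε₀, ∑ L : Fin n → Bool, bweight q L * chanDev P0 S θ L
      ≤ ∫ q in (0 : ℝ)..ε₀, (A + B * (1 / n : ℝ) ^ 2 *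
        ∑ L : Fin n → Bool, bweight q L * ∑ j, chanCov P0 S θ j L) := by
    refine intervalIntegral.integral_mono_on hε.1 ((hcont _).intervalIntegrable _ _)
      ((continuous_const.add (continuous_const.mul (hcont _))).intervalIntegrable _ _)
      fun q hq => ?_
    have hq1 : q ∈ Set.Icc (0 : ℝ) 1 := ⟨hq.1, hq.2.trans hε.2⟩
    calc ∑ L : Fin n → Bool, bweight q L * chanDev P0 S θ L
        ≤ ∑ L : Fin n → Bool, bweight q L *
          (A + B * ((1 / n : ℝ) ^ 2 * ∑ j, chanCov P0 S θ j L)) :=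
          Finset.sum_le_sum fun L _ => mul_le_mul_of_nonneg_left
            (chanDev_le θ hS hSK hK L hn hη) (bweight_nonneg hq1 L)
      _ = _ := by
          simp only [mul_add, Finset.sum_add_distrib]
          rw [← Finset.sum_mul, sum_bweight, one_mul, Finset.mul_sum]
          congr 1
          exact Finset.sum_congr rfl fun L _ => by ring
  have h2 := integral_sum_bweight_le (chanOverlap P0 S θ) (chanCov P0 S θ)
    (chanCov_nonneg θ) (chanCov_eq_zero θ hS) (chanCov_le θ hS hSK hK) hε
  have h3 : ∑ L : Fin n → Bool, bweight ε₀ L * chanOverlap P0 S θ L ≤ n * K ^ 2 := by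
    calc ∑ L : Fin n → Bool, bweight ε₀ L * chanOverlap P0 S θ L
        ≤ ∑ L : Fin n → Bool, bweight ε₀ L * (n * K ^ 2) :=
          Finset.sum_le_sum fun L _ => mul_le_mul_of_nonneg_left
            (chanOverlap_le θ hS hSK L) (bweight_nonneg hε L)
      _ = n * K ^ 2 := by rw [← Finset.sum_mul, sum_bweight, one_mul]
  have h4 : 0 ≤ ∑ L : Fin n → Bool, bweight 0 L * chanOverlap P0 S θ L :=
    Finset.sum_nonneg fun L _ => mul_nonneg (bweight_nonneg ⟨le_rfl, zero_le_one⟩ L)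
      (chanOverlap_nonneg θ L)
  have h5 : ∫ q in (0 : ℝ)..ε₀, ∑ L : Fin n → Bool, bweight q L * ∑ j, chanCov P0 S θ j L
      ≤ K ^ 2 * (n * K ^ 2) :=
    h2.trans (mul_le_mul_of_nonneg_left (by linarith) (sq_nonneg K))
  refine h1.trans ?_
  have h6 : IntervalIntegrable (fun q => B * (1 / n : ℝ) ^ 2 *
      ∑ L : Fin n → Bool, bweight q L * ∑ j, chanCov P0 S θ j L) volume 0 ε₀ :=
    (continuous_const.mul (hcont _)).intervalIntegrable _ _
  rw [intervalIntegral.integral_add (continuous_const.intervalIntegrable _ _) h6,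
    intervalIntegral.integral_const, intervalIntegral.integral_const_mul, sub_zero, smul_eq_mul]
  refine add_le_add (mul_le_of_le_one_left hA0 hε.2) ?_
  calc B * (1 / n : ℝ) ^ 2 * _ ≤ B * (1 / n : ℝ) ^ 2 * (K ^ 2 * (n * K ^ 2)) :=
        mul_le_mul_of_nonneg_left h5 (by positivity)
    _ = B * (K ^ 4 / n) := by field_simp

end Channel

/-! ### Reduction of the cavity expectation to the Gaussian channel -/

section Reduction

theorem integral_prod_le {α β : Type*} [MeasurableSpace α] [MeasurableSpace β] {μ : Measure α}
    {ν : Measure β} [SFinite μ] [SFinite ν] {f : α × β → ℝ} (hf : ∀ z, 0 ≤ f z) :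
    ∫ z, f z ∂μ.prod ν ≤ ∫ x, ∫ y, f (x, y) ∂ν ∂μ := by
  by_cases h : Integrable f (μ.prod ν)
  · rw [integral_prod _ h]
  · rw [integral_undef h]
    exact integral_nonneg fun x => integral_nonneg fun y => hf _

theorem integral_pi_eq_sum {α : Type*} [MeasurableSpace α] [MeasurableSingletonClass α]
    {μ : Measure α} [IsFiniteMeasure μ] {T : Finset α} (hT : μ (↑T)ᶜ = 0) (m : ℕ)
    (F : (Fin m → α) → ℝ) :
    ∫ x, F x ∂Measure.pi (fun _ : Fin m => μ)
      = ∑ x ∈ Fintype.piFinset fun _ : Fin m => T, (∏ i, (μ {x i}).toReal) * F x := by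
  have hae : ∀ᵐ x ∂Measure.pi (fun _ : Fin m => μ),
      x ∈ (↑(Fintype.piFinset fun _ : Fin m => T) : Set (Fin m → α)) := by
    simp only [Finset.mem_coe, Fintype.mem_piFinset]
    refine ae_all_iff.2 fun i => ?_
    have h : ∀ᵐ y ∂μ, y ∈ T := by
      rw [ae_iff]
      exact hT
    exact (Measure.quasiMeasurePreserving_eval (fun _ : Fin m => μ) i).ae h
  rw [← Measure.restrict_eq_self_of_ae_mem hae, setIntegral_finset _ IntegrableOn.finset]
  refine Finset.sum_congr rfl fun x _ => ?_
  rw [smul_eq_mul, Measure.real, Measure.pi_singleton, ENNReal.toReal_prod]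

theorem sum_piFinset_succ {α : Type*} {T : Finset α} {β : α → ℝ} (hβ : ∑ a ∈ T, β a = 1) (n : ℕ)
    (F : (Fin n → α) → ℝ) :
    ∑ x ∈ Fintype.piFinset fun _ : Fin (n + 1) => T, (∏ i, β (x i)) * F (fun i => x i.castSucc)
      = ∑ y ∈ Fintype.piFinset fun _ : Fin n => T, (∏ i, β (y i)) * F y := by
  have h : ∑ x ∈ Fintype.piFinset fun _ : Fin (n + 1) => T,
      (∏ i, β (x i)) * F (fun i => x i.castSucc)
      = ∑ p ∈ (Fintype.piFinset fun _ : Fin n => T) ×ˢ T, (∏ i, β (p.1 i)) * β p.2 * F p.1 := by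
    refine Finset.sum_nbij' (fun x => (fun i => x i.castSucc, x (Fin.last n)))
      (fun p => Fin.snoc p.1 p.2) ?_ ?_ ?_ ?_ ?_
    · intro x hx
      rw [Fintype.mem_piFinset] at hx
      exact Finset.mem_product.2 ⟨Fintype.mem_piFinset.2 fun i => hx _, hx _⟩
    · intro p hp
      obtain ⟨h1, h2⟩ := Finset.mem_product.1 hp
      rw [Fintype.mem_piFinset] at h1 ⊢
      intro i
      refine Fin.lastCases ?_ (fun i => ?_) i
      · simpa using h2
      · simpa using h1 i
    · intro x _
      ext i
      refine Fin.lastCases ?_ (fun i => ?_) i <;> simp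
    · intro p _
      ext <;> simp
    · intro x _
      rw [Fin.prod_univ_castSucc]
  rw [h, Finset.sum_product]
  refine Finset.sum_congr rfl fun y _ => ?_
  simp only
  rw [← Finset.sum_mul, ← Finset.mul_sum, hβ, mul_one]

theorem isProbabilityMeasure_bern {ε : ℝ} (hε : ε ∈ Set.Icc (0 : ℝ) 1) :
    IsProbabilityMeasure (bern ε) := by
  constructor
  rw [bern, Measure.add_apply, Measure.smul_apply, Measure.smul_apply, smul_eq_mul,
    smul_eq_mul, measure_univ, measure_univ, mul_one, mul_one, ← ENNReal.ofReal_add hε.1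
    (sub_nonneg.2 hε.2)]
  simp

theorem bern_singleton {ε : ℝ} (hε : ε ∈ Set.Icc (0 : ℝ) 1) (b : Bool) :
    (bern ε {b}).toReal = bprob ε b := by
  cases b <;> simp [bern, bprob, hε.1, sub_nonneg.2 hε.2]

theorem sum_singleton_eq_one {P0 : Measure ℝ} [IsProbabilityMeasure P0] {S : Finset ℝ}
    (hsupp : P0 ((↑S : Set ℝ)ᶜ) = 0) : ∑ σ ∈ S, (P0 {σ}).toReal = 1 := by
  have h : P0 (↑S : Set ℝ) = 1 := (prob_compl_eq_zero_iff S.measurableSet).1 hsupp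
  rw [← ENNReal.toReal_sum fun _ _ => measure_ne_top _ _, sum_measure_singleton, h,
    ENNReal.toReal_one]

variable {n : ℕ}

/-- The pairs of sites not involving the cavity site in the second slot. -/
abbrev BulkPair (n : ℕ) := {k : Fin (n + 1) × Fin (n + 1) // ¬ k.2 = Fin.last n}

/-- The pairs of sites with the cavity site in the second slot. -/
abbrev CavityPair (n : ℕ) := {k : Fin (n + 1) × Fin (n + 1) // ¬ ¬ k.2 = Fin.last n}

/-- The inclusion of the pairs of bulk sites. -/
def bulkPair (p : Fin n × Fin n) : BulkPair n :=
  ⟨(p.1.castSucc, p.2.castSucc), Fin.castSucc_ne_last _⟩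

/-- The pair of a bulk site and the cavity site. -/
def cavityPair (i : Fin n) : CavityPair n := ⟨(i.castSucc, Fin.last n), not_not.2 rfl⟩

theorem bulkPair_injective : Function.Injective (bulkPair (n := n)) := fun p q h => by
  simpa [bulkPair, Prod.ext_iff] using h

theorem cavityPair_injective : Function.Injective (cavityPair (n := n)) := fun p q h => by
  simpa [cavityPair] using h

/-- The signal observed through the channel defining the cavity Hamiltonian. -/
def cavSignal (lam : ℝ) (x : Fin n → ℝ) : BulkPair n → ℝ :=
  pad bulkPair fun p => if p.1 < p.2 then √(lam / (n + 1)) * (x p.1 * x p.2) else 0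

theorem exp_Hcav {lam : ℝ} (hlam : 0 ≤ lam) (ω : CavΩ n) (x : Fin n → ℝ) :
    Real.exp (Hcav n lam ω x)
      = chan (cavSignal lam)
          ((fun k : BulkPair n => ω.2.1 k.1) + cavSignal lam fun i => ω.1 i.castSucc) x := by
  rw [chan, Hcav]
  congr 1
  have h1 : ∀ k, cavSignal lam x k * ((fun k : BulkPair n => ω.2.1 k.1)
      + cavSignal lam fun i => ω.1 i.castSucc) k - cavSignal lam x k ^ 2 / 2
      = cavSignal lam x k * (ω.2.1 k.1 + cavSignal lam (fun i => ω.1 i.castSucc) k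
        - cavSignal lam x k / 2) := fun k => by
    rw [Pi.add_apply]; ring
  have hs : √(lam / (n + 1)) * √(lam / (n + 1)) = lam / (n + 1) :=
    Real.mul_self_sqrt (by positivity)
  simp only [h1]
  rw [cavSignal, sum_pad_mul bulkPair_injective, pairs, Finset.sum_filter]
  refine Finset.sum_congr rfl fun p _ => ?_
  rw [cavSignal, pad_apply bulkPair_injective, pad_apply bulkPair_injective]
  split_ifs with h
  · have e : lam / (2 * ((n : ℝ) + 1)) = lam / (n + 1) / 2 := by field_simp
    simp only [bulkPair]
    rw [e]
    generalize √(lam / ((n : ℝ) + 1)) = s at hs ⊢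
    rw [← hs]
    ring
  · simp

theorem cavity_sub_eq_cavDiff (P0 : Measure ℝ) (S : Finset ℝ) {lam : ℝ} (hlam : 0 ≤ lam)
    (ω : CavΩ n) :
    Ucav P0 S n lam ω - Vcav P0 S n lam ω
      = cavDiff P0 S lam
          (chan (cavSignal lam)
            ((fun k : BulkPair n => ω.2.1 k.1) + cavSignal lam fun i => ω.1 i.castSucc))
          (fun i => ω.2.2.1 i.castSucc) (ω.2.2.1 (Fin.last n)) (fun i => ω.1 i.castSucc)
          (ω.1 (Fin.last n)) (fun i => ω.2.1 (i.castSucc, Fin.last n)) := by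
  have h : ∀ f, gibbs P0 S n lam ω f = gavg P0 S
      (chan (cavSignal lam)
        ((fun k : BulkPair n => ω.2.1 k.1) + cavSignal lam fun i => ω.1 i.castSucc))
      (fun i => ω.2.2.1 i.castSucc) (fun i => ω.1 i.castSucc) f := fun f => by
    rw [gibbs]
    simp only [exp_Hcav hlam]
    rfl
  simp only [Ucav, Vcav, Qoverlap, bcoef, h]
  rfl

variable {P0 : Measure ℝ} {S : Finset ℝ} {K lam : ℝ}

/-- The expectation over the Gaussian noise, at fixed signal. -/
theorem integral_noise_le (hS : ∑ σ ∈ S, (P0 {σ}).toReal = 1) (hSK : ∀ σ ∈ S, |σ| ≤ K)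
    (hK : 0 ≤ K) (hlam : 0 ≤ lam) {ε : ℝ} (hε : ε ∈ Set.Icc (0 : ℝ) 1) {X : Fin n → ℝ}
    (hX : X ∈ confs S n) {X' : ℝ} (hX' : X' ∈ S) :
    ∫ Z : (Fin (n + 1) × Fin (n + 1)) → ℝ, ∑ L : Fin (n + 1) → Bool, bweight ε L *
        cavDiff P0 S lam (chan (cavSignal lam) ((fun k : BulkPair n => Z k.1) + cavSignal lam X))
          (fun i => L i.castSucc) (L (Fin.last n)) X X' (fun i => Z (i.castSucc, Fin.last n)) ^ 2
        ∂Measure.pi (fun _ => stdGauss)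
      ≤ Real.exp (3 * lam * K ^ 4) * (lam * K ^ 2) * ∑ L : Fin n → Bool, bweight ε L *
        ∫ v, gdev P0 S (chan (cavSignal lam) (v + cavSignal lam X)) L X ∂gaussVec (BulkPair n) := by
  set C := Real.exp (3 * lam * K ^ 4) * (lam * K ^ 2) with hC
  have hC0 : 0 ≤ C := by positivity
  set D : (BulkPair n → ℝ) → (CavityPair n → ℝ) → (Fin (n + 1) → Bool) → ℝ := fun v u L =>
    cavDiff P0 S lam (chan (cavSignal lam) (v + cavSignal lam X))
          (fun i => L i.castSucc) (L (Fin.last n)) X X' (fun i => u (cavityPair i)) ^ 2 with hD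
  have hmp := measurePreserving_piEquivPiSubtypeProd
    (fun _ : Fin (n + 1) × Fin (n + 1) => stdGauss) (fun k => ¬ k.2 = Fin.last n)
  have hint : ∀ L, Integrable (fun v => gdev P0 S (chan (cavSignal lam) (v + cavSignal lam X))
      L X) (gaussVec (BulkPair n)) := fun L =>
    Integrable.of_bound ((continuous_gdev_chan (cavSignal lam) hS L X).comp
      (continuous_id.add continuous_const)).aestronglyMeasurable (14 * K ^ 2)
      (ae_of_all _ fun v => abs_gdev_le hS (chan_pos _ _) hSK hK L hX)
  calc _ = ∫ z : (BulkPair n → ℝ) × (CavityPair n → ℝ),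
          ∑ L : Fin (n + 1) → Bool, bweight ε L * D z.1 z.2 L
          ∂(gaussVec (BulkPair n)).prod (gaussVec (CavityPair n)) :=
        hmp.integral_comp' (g := fun z : (BulkPair n → ℝ) × (CavityPair n → ℝ) =>
          ∑ L : Fin (n + 1) → Bool, bweight ε L * D z.1 z.2 L)
    _ ≤ ∫ v, ∫ u, ∑ L : Fin (n + 1) → Bool, bweight ε L * D v u L
          ∂gaussVec (CavityPair n) ∂gaussVec (BulkPair n) :=
        integral_prod_le fun z => Finset.sum_nonneg fun L _ =>
          mul_nonneg (bweight_nonneg hε L) (sq_nonneg _)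
    _ ≤ ∫ v, ∑ L : Fin (n + 1) → Bool, bweight ε L * (C * gdev P0 S
          (chan (cavSignal lam) (v + cavSignal lam X)) (fun i => L i.castSucc) X)
          ∂gaussVec (BulkPair n) := by
        refine integral_mono_of_nonneg (ae_of_all _ fun v => integral_nonneg fun u =>
          Finset.sum_nonneg fun L _ => mul_nonneg (bweight_nonneg hε L) (sq_nonneg _))
          (integrable_finsetSum _ fun L _ => ((hint _).const_mul C).const_mul _)
          (ae_of_all _ fun v => ?_)
        simp only
        rw [integral_finsetSum _ fun L _ => (integrable_cavDiff_sq hS (chan_pos _ _) hlam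
          cavityPair_injective _ _ _ _).const_mul _]
        refine Finset.sum_le_sum fun L _ => ?_
        rw [integral_const_mul]
        exact mul_le_mul_of_nonneg_left (integral_cavDiff_sq_le hS (chan_pos _ _) hSK hK hlam
          cavityPair_injective _ _ hX hX') (bweight_nonneg hε L)
    _ = ∑ L : Fin (n + 1) → Bool, bweight ε L * (C * ∫ v, gdev P0 S
          (chan (cavSignal lam) (v + cavSignal lam X)) (fun i => L i.castSucc) X
          ∂gaussVec (BulkPair n)) := by
        rw [integral_finsetSum _ fun L _ => ((hint _).const_mul C).const_mul _]
        simp only [integral_const_mul]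
    _ = _ := by
        have h := sum_piFinset_succ (T := Finset.univ) (sum_bprob ε) n fun L => C * ∫ v, gdev P0 S
          (chan (cavSignal lam) (v + cavSignal lam X)) L X ∂gaussVec (BulkPair n)
        simp only [Fintype.piFinset_univ] at h
        refine h.trans ?_
        rw [Finset.mul_sum]
        exact Finset.sum_congr rfl fun L _ => mul_left_comm _ _ _

theorem integral_cavMeas_le [IsProbabilityMeasure P0] (hsupp : P0 ((↑S : Set ℝ)ᶜ) = 0)
    (hSK : ∀ σ ∈ S, |σ| ≤ K) (hK : 0 ≤ K) (hlam : 0 ≤ lam) {ε : ℝ} (hε : ε ∈ Set.Icc (0 : ℝ) 1) :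
    ∫ ω, (Ucav P0 S n lam ω - Vcav P0 S n lam ω) ^ 2 ∂cavMeas P0 n ε
      ≤ Real.exp (3 * lam * K ^ 4) * (lam * K ^ 2) * ∑ L : Fin n → Bool, bweight ε L *
        chanDev P0 S (cavSignal lam) L := by
  have hS := sum_singleton_eq_one hsupp
  have := isProbabilityMeasure_bern hε
  set C := Real.exp (3 * lam * K ^ 4) * (lam * K ^ 2) with hC
  have hdisc : ∀ (X : Fin (n + 1) → ℝ) (Z : (Fin (n + 1) × Fin (n + 1)) → ℝ),
      ∫ a : (Fin (n + 1) → Bool) × (Fin (n + 1) → ℝ) × ((Fin (n + 1) × Fin (n + 1)) → ℝ),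
        (Ucav P0 S n lam (X, Z, a) - Vcav P0 S n lam (X, Z, a)) ^ 2
          ∂(Measure.pi fun _ : Fin (n + 1) => bern ε).prod
        ((Measure.pi fun _ : Fin (n + 1) => stdGauss).prod
          (Measure.pi fun _ : Fin (n + 1) × Fin (n + 1) => stdGauss))
      = ∑ L : Fin (n + 1) → Bool, bweight ε L *
        cavDiff P0 S lam (chan (cavSignal lam)
          ((fun k : BulkPair n => Z k.1) + cavSignal lam fun i => X i.castSucc))
          (fun i => L i.castSucc) (L (Fin.last n)) (fun i => X i.castSucc) (X (Fin.last n))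
          (fun i => Z (i.castSucc, Fin.last n)) ^ 2 := fun X Z => by
    simp only [cavity_sub_eq_cavDiff P0 S hlam]
    rw [integral_fun_fst (f := fun L : Fin (n + 1) → Bool => cavDiff P0 S lam
      (chan (cavSignal lam) ((fun k : BulkPair n => Z k.1) + cavSignal lam fun i => X i.castSucc))
          (fun i => L i.castSucc) (L (Fin.last n)) (fun i => X i.castSucc) (X (Fin.last n))
          (fun i => Z (i.castSucc, Fin.last n)) ^ 2), integral_pi_eq_sum (T := Finset.univ)
      (by rw [Finset.coe_univ, Set.compl_univ, measure_empty]), Fintype.piFinset_univ]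
    simp only [bern_singleton hε, probReal_univ, one_smul]
    rfl
  calc _ ≤ ∫ X, ∫ b, (Ucav P0 S n lam (X, b) - Vcav P0 S n lam (X, b)) ^ 2
          ∂((Measure.pi fun _ : Fin (n + 1) × Fin (n + 1) => stdGauss).prod
      ((Measure.pi fun _ : Fin (n + 1) => bern ε).prod
        ((Measure.pi fun _ : Fin (n + 1) => stdGauss).prod
          (Measure.pi fun _ : Fin (n + 1) × Fin (n + 1) => stdGauss))))
          ∂Measure.pi fun _ : Fin (n + 1) => P0 := integral_prod_le fun _ => sq_nonneg _
    _ = ∑ X ∈ confs S (n + 1), weight P0 (n + 1) X *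
          ∫ b, (Ucav P0 S n lam (X, b) - Vcav P0 S n lam (X, b)) ^ 2
          ∂((Measure.pi fun _ : Fin (n + 1) × Fin (n + 1) => stdGauss).prod
      ((Measure.pi fun _ : Fin (n + 1) => bern ε).prod
        ((Measure.pi fun _ : Fin (n + 1) => stdGauss).prod
          (Measure.pi fun _ : Fin (n + 1) × Fin (n + 1) => stdGauss)))) :=
        integral_pi_eq_sum hsupp _ _
    _ ≤ ∑ X ∈ confs S (n + 1), weight P0 (n + 1) X * (C * ∑ L : Fin n → Bool, bweight ε L *
          ∫ v, gdev P0 S (chan (cavSignal lam) (v + cavSignal lam fun i => X i.castSucc)) L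
            (fun i => X i.castSucc) ∂gaussVec (BulkPair n)) := by
        refine Finset.sum_le_sum fun X hX => mul_le_mul_of_nonneg_left ?_ (weight_nonneg P0 X)
        refine (integral_prod_le fun _ => sq_nonneg _).trans ?_
        simp only [hdisc]
        have hX' := Fintype.mem_piFinset.1 hX
        exact integral_noise_le hS hSK hK hlam hε (Fintype.mem_piFinset.2 fun i => hX' _) (hX' _)
    _ = ∑ X ∈ confs S n, weight P0 n X * (C * ∑ L : Fin n → Bool, bweight ε L *
          ∫ v, gdev P0 S (chan (cavSignal lam) (v + cavSignal lam X)) L X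
            ∂gaussVec (BulkPair n)) :=
        sum_piFinset_succ hS n fun X => C * ∑ L : Fin n → Bool, bweight ε L *
          ∫ v, gdev P0 S (chan (cavSignal lam) (v + cavSignal lam X)) L X ∂gaussVec (BulkPair n)
    _ = C * ∑ L : Fin n → Bool, bweight ε L * ∑ X ∈ confs S n, weight P0 n X *
          ∫ v, gdev P0 S (chan (cavSignal lam) (v + cavSignal lam X)) L X
            ∂gaussVec (BulkPair n) := by
        simp only [Finset.mul_sum]
        rw [Finset.sum_comm]
        exact Finset.sum_congr rfl fun L _ => Finset.sum_congr rfl fun X _ => by ring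
    _ = _ := by
        congr 1
        refine Finset.sum_congr rfl fun L _ => ?_
        rw [chanDev, ← sum_weight_mul_integral_eq (cavSignal lam)
          (F := fun v X => gdev P0 S (chan (cavSignal lam) v) L X)
          (fun X => continuous_gdev_chan _ hS L X)
          fun v X hX => abs_gdev_le hS (chan_pos _ v) hSK hK L hX]

end Reduction

theorem integral_cavity_le {P0 : Measure ℝ} [IsProbabilityMeasure P0] {S : Finset ℝ} {K lam : ℝ}
    (hsupp : P0 ((↑S : Set ℝ)ᶜ) = 0) (hSK : ∀ σ ∈ S, |σ| ≤ K) (hK : 0 ≤ K) (hlam : 0 ≤ lam) {n : ℕ}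
    (hn : 0 < n) {η : ℝ} (hη : 0 < η) {ε₀ : ℝ} (hε : ε₀ ∈ Set.Icc (0 : ℝ) 1) :
    ∫ ε in (0 : ℝ)..ε₀, ∫ ω, (Ucav P0 S n lam ω - Vcav P0 S n lam ω) ^ 2 ∂cavMeas P0 n ε
      ≤ Real.exp (3 * lam * K ^ 4) * (lam * K ^ 2) *
        ((7 + 14 * K ^ 2) * η + 7 / η * (1 + 2 * K ^ 2 / η ^ 2) * (K ^ 4 / n)) := by
  refine le_trans ?_ (mul_le_mul_of_nonneg_left (integral_sum_bweight_chanDev_le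
    (cavSignal lam) (sum_singleton_eq_one hsupp) hSK hK hn hη hε) (by positivity))
  rw [← intervalIntegral.integral_const_mul, intervalIntegral.integral_of_le hε.1,
    intervalIntegral.integral_of_le hε.1]
  refine integral_mono_of_nonneg (ae_of_all _ fun ε => integral_nonneg fun ω => sq_nonneg _) ?_
    ((ae_restrict_iff' measurableSet_Ioc).2 (ae_of_all _ fun ε hq =>
      integral_cavMeas_le hsupp hSK hK hlam ⟨hq.1.le, hq.2.trans hε.2⟩))
  exact (continuous_const.mul (continuous_finsetSum _ fun L _ =>
    (continuous_bweight L).mul continuous_const)).integrableOn_Ioc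

/-- **L² closeness of the cavity fields `U` and `V`**:
`∫_0^{ε₀} E[(U − V)²] dε → 0` as `n → ∞`. -/
theorem cavity_fields_L2_close (P0 : Measure ℝ) [IsProbabilityMeasure P0]
    (S : Finset ℝ) (K : ℝ) (hK : 0 < K) (hSK : ∀ x ∈ S, x ∈ Set.Icc (-K) K)
    (hsupp : P0 ((↑S : Set ℝ)ᶜ) = 0) (lam : ℝ) (hlam : 0 < lam)
    (ε₀ : ℝ) (hε₀ : ε₀ ∈ Set.Ioc (0 : ℝ) 1) :
    Tendsto (fun n => ∫ ε in (0 : ℝ)..ε₀,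
        ∫ ω, (Ucav P0 S n lam ω - Vcav P0 S n lam ω) ^ 2 ∂cavMeas P0 n ε)
      atTop (nhds 0) := by
  have hSK' : ∀ σ ∈ S, |σ| ≤ K := fun σ hσ => abs_le.2 (hSK σ hσ)
  set C := Real.exp (3 * lam * K ^ 4) * (lam * K ^ 2) with hC
  set A := C * (7 + 14 * K ^ 2) with hA
  have hA0 : 0 ≤ A := by positivity
  refine tendsto_order.2 ⟨fun a ha => Eventually.of_forall fun n => ha.trans_le
    (intervalIntegral.integral_nonneg hε₀.1.le fun ε _ => integral_nonneg fun ω => sq_nonneg _),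
    fun δ hδ => ?_⟩
  set η := δ / (2 * (A + 1)) with hη
  have hη0 : 0 < η := by positivity
  have hAη : A * η < δ / 2 := by
    rw [hη, mul_div_assoc', div_lt_div_iff₀ (by positivity) two_pos]
    nlinarith
  have hlim : Tendsto (fun n : ℕ => C * (7 / η * (1 + 2 * K ^ 2 / η ^ 2)) * K ^ 4 / (n : ℝ))
      atTop (nhds 0) := tendsto_const_div_atTop_nhds_zero_nat _
  filter_upwards [hlim.eventually_lt_const (half_pos hδ), eventually_gt_atTop 0] with n hn hn0
  refine (integral_cavity_le hsupp hSK' hK.le hlam.le hn0 hη0 ⟨hε₀.1.le, hε₀.2⟩).trans_lt ?_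
  calc _ = A * η + C * (7 / η * (1 + 2 * K ^ 2 / η ^ 2)) * K ^ 4 / (n : ℝ) := by
        rw [hA, hC]; ring
    _ < δ / 2 + δ / 2 := add_lt_add hAη hn
    _ = δ := add_halves δ

end
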